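/- Let d ≥ 2 and k, n be integers with 1 ≤ k − 1 ≤ n ≤ d, and let ε > 0. There exists C > 0 such that the following holds for every odd prime power q. Let Q be a nondegenerate quadratic form on 𝔽_q^d, let H be a graph on vertex set {1, …, k} with exactly n edges, and let c assign to each edge of H a color in 𝔽_q* = 𝔽_q \ {0}. Let E ⊆ 𝔽_q^d with |E| ≥ C·q^{(d−1)/2 + k − 1}. Then the number N of k-tuples (x₁, …, x_k) of distinct points of E such that Q(x_i − x_j) = c({i, j}) for every edge {i, j} of H satisfies |N − |E|^k·q^{−n}| ≤ ε·|E|^k·q^{−n}. -/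

import Mathlib

open Finset
open scoped Classical

open Polynomial in
theorem Polynomial.eval_X_pow_eq_zero {K : Type*} [Field K] {N : ℕ} (G : K[X][X])
    (hG : ∀ j, (G.coeff j).natDegree < N) (h : G.eval (X ^ N) = 0) : G = 0 := by
  by_contra hne
  have hlc : G.coeff G.natDegree ≠ 0 := leadingCoeff_ne_zero.mpr hne
  have hsum := G.eval_eq_sum_range (X ^ N : K[X])
  rw [h, Finset.sum_range_succ] at hsum
  have hdeg : (∑ i ∈ range G.natDegree, G.coeff i * (X ^ N) ^ i : K[X]).degree <
      (G.coeff G.natDegree * (X ^ N) ^ G.natDegree : K[X]).degree := by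
    have h1 : (G.coeff G.natDegree * (X ^ N) ^ G.natDegree : K[X]).degree
        = (((G.coeff G.natDegree).natDegree + N * G.natDegree : ℕ) : WithBot ℕ) := by
      rw [degree_mul, ← pow_mul, degree_X_pow, degree_eq_natDegree hlc]; rfl
    rw [h1]
    refine (degree_sum_le _ _).trans_lt ?_
    rw [Finset.sup_lt_iff (WithBot.bot_lt_coe _)]
    intro i hi
    rw [Finset.mem_range] at hi
    by_cases hi0 : G.coeff i = 0
    · simp [hi0]; exact WithBot.bot_lt_coe _
    rw [degree_mul, ← pow_mul, degree_X_pow, degree_eq_natDegree hi0, ← Nat.cast_add]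
    have := hG i
    norm_cast
    nlinarith
  have := degree_add_eq_right_of_degree_lt hdeg
  rw [← hsum, degree_zero] at this
  have h0 : (G.coeff G.natDegree * (X ^ N) ^ G.natDegree : K[X]) ≠ 0 :=
    mul_ne_zero hlc (pow_ne_zero _ (pow_ne_zero _ X_ne_zero))
  exact h0 (degree_eq_bot.mp this.symm)

open Polynomial in
theorem Squarefree.sq_ne_mul_sq {K : Type*} [Field K] {f p d : K[X]} (hf : Squarefree f)
    (hf0 : 0 < f.natDegree) (hd : d ≠ 0) {c : K} (hc : c ≠ 0) :
    p ^ 2 ≠ C c * f * d ^ 2 := by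
  intro h
  have hfu : ¬ IsUnit f := fun hu => by
    rw [natDegree_eq_zero_of_isUnit hu] at hf0; exact lt_irrefl _ hf0
  have hfne : f ≠ 0 := hf.ne_zero
  have hp : p ≠ 0 := by
    rintro rfl
    have : C c * f * d ^ 2 ≠ 0 :=
      mul_ne_zero (mul_ne_zero (C_ne_zero.mpr hc) hfne) (pow_ne_zero _ hd)
    apply this; rw [← h]; simp
  obtain ⟨π, hπ, hπf⟩ := WfDvdMonoid.exists_irreducible_factor hfu hfne
  have hpr : Prime π := hπ.prime
  have h1 : multiplicity π f = 1 := by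
    have := (squarefree_iff_emultiplicity_le_one f).mp hf π
    have h2 : emultiplicity π f ≤ 1 := this.resolve_right hπ.not_isUnit
    have hfin : FiniteMultiplicity π f := FiniteMultiplicity.of_prime_left hpr hfne
    rw [hfin.emultiplicity_eq_multiplicity] at h2
    have h3 : multiplicity π f ≠ 0 := by
      rw [Ne, multiplicity_eq_zero]; exact not_not.mpr hπf
    have : multiplicity π f ≤ 1 := by exact_mod_cast h2
    omega
  have hfin : ∀ g : K[X], g ≠ 0 → FiniteMultiplicity π g := fun g hg =>
    FiniteMultiplicity.of_prime_left hpr hg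
  have e := congrArg (multiplicity π) h
  rw [multiplicity_mul hpr (hfin _ (mul_ne_zero (mul_ne_zero (C_ne_zero.mpr hc) hfne)
    (pow_ne_zero _ hd))), multiplicity_mul hpr (hfin _ (mul_ne_zero (C_ne_zero.mpr hc) hfne)),
    (hfin _ hp).multiplicity_pow hpr, (hfin _ hd).multiplicity_pow hpr, h1] at e
  have hc1 : multiplicity π (C c) = 0 := by
    rw [multiplicity_eq_zero]
    intro hdiv
    exact hπ.not_isUnit (isUnit_of_dvd_unit hdiv (isUnit_C.mpr hc.isUnit))
  omega

open Polynomial in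
/-- If `f` is squarefree and nonconstant, the functions `X ^ (q₀ j)` and
`f ^ ((q₀ + 1) / 2) * X ^ (q₀ j)` are linearly independent over polynomials of small degree. -/
theorem Polynomial.stepanov_independent {K : Type*} [Field K] {p r q₀ : ℕ} [ExpChar K p]
    (hq₀ : q₀ = p ^ r) (hodd : Odd q₀) {f : K[X]} (hf : Squarefree f) (hf0 : 0 < f.natDegree)
    {P D : K[X][X]} (hP : ∀ j, 2 * (P.coeff j).natDegree < q₀)
    (hD : ∀ j, f.natDegree + 2 * (D.coeff j).natDegree < q₀)
    (h : P.eval (X ^ q₀) + f ^ ((q₀ + 1) / 2) * D.eval (X ^ q₀) = 0) : P = 0 ∧ D = 0 := by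
  set g : K[X] := f.map (iterateFrobenius K p r) with hg
  have hg0 : g ≠ 0 := by
    rw [hg, Ne, Polynomial.map_eq_zero]; exact hf.ne_zero
  have hgf : (g.map C).eval (X ^ q₀ : K[X]) = f ^ q₀ := by
    have := map_iterateFrobenius_expand p f r
    rw [← hq₀] at this
    rw [← this, hg, eval_map, Polynomial.map_expand, expand_eq_comp_X_pow, comp]
  have hcoeffsq : ∀ (R : K[X][X]) (b : ℕ), (∀ j, 2 * (R.coeff j).natDegree ≤ b) →
      ∀ j, ((R ^ 2).coeff j).natDegree ≤ b := by
    intro R b hR j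
    rw [sq, coeff_mul]
    refine natDegree_sum_le_of_forall_le _ _ ?_
    intro x _
    refine natDegree_mul_le.trans ?_
    have := hR x.1
    have := hR x.2
    omega
  have hG : P ^ 2 - C f * g.map C * D ^ 2 = 0 := by
    apply eval_X_pow_eq_zero (N := q₀)
    · intro j
      have hq : 0 < q₀ := hodd.pos
      have h1 : ((P ^ 2).coeff j).natDegree ≤ q₀ - 1 := by
        refine hcoeffsq P _ (fun j => ?_) j
        have := hP j
        omega
      have h2 : ((C f * g.map C * D ^ 2).coeff j).natDegree ≤ q₀ - 1 := by
        rw [mul_assoc, coeff_C_mul, coeff_mul]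
        refine natDegree_mul_le.trans ?_
        have : (∑ x ∈ antidiagonal j, (g.map C).coeff x.1 * (D ^ 2).coeff x.2 : K[X]).natDegree
            ≤ q₀ - 1 - f.natDegree := by
          refine natDegree_sum_le_of_forall_le _ _ ?_
          intro x _
          refine natDegree_mul_le.trans ?_
          rw [coeff_map, natDegree_C, zero_add]
          refine hcoeffsq D _ (fun j => ?_) _
          have := hD j
          omega
        have := hD 0
        omega
      rw [coeff_sub]
      have := (natDegree_sub_le ((P ^ 2).coeff j) ((C f * g.map C * D ^ 2).coeff j))
      have := this.trans (max_le h1 h2)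
      omega
    · rw [eval_sub, eval_mul, eval_mul, hgf, eval_C, eval_pow, eval_pow]
      have hh : P.eval (X ^ q₀) = - (f ^ ((q₀ + 1) / 2) * D.eval (X ^ q₀)) := by
        linear_combination h
      rw [hh]
      have : f * f ^ q₀ = (f ^ ((q₀ + 1) / 2)) ^ 2 := by
        rw [← pow_mul, ← pow_succ']
        congr 1
        obtain ⟨t, rfl⟩ := hodd
        omega
      rw [this]; ring
  have hD0 : D = 0 := by
    by_contra hD0
    have hl := congrArg leadingCoeff (sub_eq_zero.mp hG)
    rw [leadingCoeff_mul, leadingCoeff_mul, leadingCoeff_pow, leadingCoeff_pow, leadingCoeff_C,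
      leadingCoeff_map_of_injective (C_injective)] at hl
    exact hf.sq_ne_mul_sq hf0 (leadingCoeff_ne_zero.mpr hD0)
      (leadingCoeff_ne_zero.mpr hg0) (by rw [hl]; ring)
  refine ⟨?_, hD0⟩
  rw [hD0] at hG
  simpa using hG

open Polynomial in
theorem Polynomial.natCard_degreeLT (K : Type*) [Field K] (n : ℕ) :
    Nat.card (degreeLT K n) = Nat.card K ^ n := by
  rw [Nat.card_congr (degreeLTEquiv K n).toEquiv, Nat.card_fun, Nat.card_fin]

open Polynomial in
theorem Polynomial.natDegree_lt_of_mem_degreeLT {K : Type*} [Field K] {n : ℕ} (hn : 0 < n)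
    {P : K[X]} (hP : P ∈ degreeLT K n) : P.natDegree < n := by
  rw [mem_degreeLT] at hP
  by_cases h : P = 0
  · simpa [h] using hn
  · exact (natDegree_lt_iff_degree_lt h).mpr hP

open Polynomial in
/-- Existence of the auxiliary coefficients in Stepanov's method, by counting. -/
theorem Polynomial.exists_stepanov_coeffs {K : Type*} [Field K] [Finite K] {p r q₀ : ℕ}
    [ExpChar K p] (hq₀ : q₀ = p ^ r) (g : K[X]) {A B J : ℕ} (hA : 0 < A) (hB : 0 < B)
    (hg : g.natDegree + q₀ * B ≤ q₀ * A) (hJ : q₀ * A + J < J * (A + B)) :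
    ∃ α δ : Fin J → K[X], (∀ j, (α j).natDegree < A) ∧ (∀ j, (δ j).natDegree < B) ∧
      (∃ j, α j ≠ 0 ∨ δ j ≠ 0) ∧
      ∑ j, (α j ^ q₀ + g * δ j ^ q₀) * X ^ (j : ℕ) = 0 := by
  let U := (Fin J → degreeLT K A) × (Fin J → degreeLT K B)
  let Φ : U → K[X] := fun u => ∑ j, ((u.1 j : K[X]) ^ q₀ + g * (u.2 j : K[X]) ^ q₀) * X ^ (j : ℕ)
  have hΦ : ∀ u, Φ u ∈ degreeLT K (q₀ * A + J) := by
    intro u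
    refine Submodule.sum_mem _ fun j _ => ?_
    rw [mem_degreeLT]
    refine (degree_le_natDegree).trans_lt ?_
    norm_cast
    refine natDegree_mul_le.trans_lt ?_
    rw [natDegree_X_pow]
    refine add_lt_add_of_le_of_lt ?_ j.2
    have h1 := natDegree_lt_of_mem_degreeLT hA (u.1 j).2
    have h2 := natDegree_lt_of_mem_degreeLT hB (u.2 j).2
    refine (natDegree_add_le _ _).trans (max_le ?_ ?_)
    · refine natDegree_pow_le.trans (Nat.mul_le_mul_left _ h1.le)
    · refine natDegree_mul_le.trans ((add_le_add_right ?_ _).trans hg)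
      exact natDegree_pow_le.trans (Nat.mul_le_mul_left _ h2.le)
  have hK : 1 < Nat.card K := Finite.one_lt_card
  have : Finite (degreeLT K A) := Finite.of_equiv _ (degreeLTEquiv K A).symm.toEquiv
  have : Finite (degreeLT K B) := Finite.of_equiv _ (degreeLTEquiv K B).symm.toEquiv
  have : Finite (degreeLT K (q₀ * A + J)) := Finite.of_equiv _ (degreeLTEquiv K _).symm.toEquiv
  have hcard : Nat.card (degreeLT K (q₀ * A + J)) < Nat.card U := by
    rw [Nat.card_prod, Nat.card_fun, Nat.card_fun, natCard_degreeLT, natCard_degreeLT,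
      natCard_degreeLT, Nat.card_fin, ← pow_mul, ← pow_mul, ← pow_add]
    apply Nat.pow_lt_pow_right hK
    calc _ < _ := hJ
      _ = _ := by ring
  have hninj : ¬ Function.Injective (fun u : U => (⟨Φ u, hΦ u⟩ : degreeLT K (q₀ * A + J))) :=
    fun hinj => absurd (Nat.card_le_card_of_injective _ hinj) (not_le.mpr hcard)
  rw [Function.not_injective_iff] at hninj
  obtain ⟨u, v, huv, hne⟩ := hninj
  have huv' : Φ u = Φ v := congrArg Subtype.val huv
  refine ⟨fun j => u.1 j - v.1 j, fun j => u.2 j - v.2 j, ?_, ?_, ?_, ?_⟩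
  · exact fun j => natDegree_lt_of_mem_degreeLT hA (Submodule.sub_mem _ (u.1 j).2 (v.1 j).2)
  · exact fun j => natDegree_lt_of_mem_degreeLT hB (Submodule.sub_mem _ (u.2 j).2 (v.2 j).2)
  · by_contra! hcon
    apply hne
    ext j : 2
    · exact Subtype.ext (sub_eq_zero.mp (hcon j).1)
    · exact Subtype.ext (sub_eq_zero.mp (hcon j).2)
  · rw [← sub_eq_zero.mpr huv', ← Finset.sum_sub_distrib]
    refine Finset.sum_congr rfl fun j _ => ?_
    rw [hq₀, sub_pow_expChar_pow, sub_pow_expChar_pow]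
    ring

open Polynomial in
theorem Polynomial.two_mul_card_eval_pow_eq_le {K : Type*} [Field K] [Fintype K] {p r q₀ : ℕ}
    [ExpChar K p] (hq₀ : q₀ = p ^ r) (hodd : Odd q₀) (hK : Fintype.card K = q₀ ^ 2) {f : K[X]}
    (hf : Squarefree f) (hf0 : 0 < f.natDegree) (hm : 8 * f.natDegree ≤ q₀) (θ : K) :
    2 * #{x : K | f.eval x ^ ((q₀ ^ 2 - 1) / 2) = θ} ≤
      q₀ ^ 2 + (10 * f.natDegree + 4) * q₀ := by
  set m := f.natDegree with hmdef
  set e := (q₀ + 1) / 2 with he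
  set B := q₀ / 4 with hBdef
  set A := B + m with hAdef
  set J := (q₀ + (8 * m + 1)) / 2 with hJdef
  obtain ⟨t, ht⟩ := hodd
  have he' : e = t + 1 := by omega
  have hJ' : J = t + 4 * m + 1 := by omega
  have hB4 : 4 * B ≤ q₀ := by omega
  have hB8 : q₀ ≤ 8 * B := by omega
  have hB : 0 < B := by omega
  have hA : 0 < A := by omega
  have hfe : (C θ * f ^ e).natDegree ≤ m * e := by
    refine (natDegree_C_mul_le _ _).trans ?_
    rw [natDegree_pow, mul_comm]
  have hge : (C θ * f ^ e).natDegree + q₀ * B ≤ q₀ * A := by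
    have : m * e ≤ q₀ * m := by
      rw [mul_comm q₀]
      exact Nat.mul_le_mul_left _ (by omega)
    rw [hAdef, mul_add]
    omega
  have hJA : q₀ * A + J < J * (A + B) := by
    rw [hJ', hAdef, ht]
    have : 2 * t + 1 ≤ 8 * B := by omega
    nlinarith [Nat.mul_le_mul_left m this, Nat.mul_le_mul_left t hf0, Nat.mul_le_mul_left m hf0]
  obtain ⟨α, δ, hα, hδ, ⟨j₀, hj₀⟩, hsum⟩ := exists_stepanov_coeffs hq₀ (C θ * f ^ e) hA hB hge hJA
  let lift : (Fin J → K[X]) → K[X][X] := fun a => ∑ j : Fin J, monomial (j : ℕ) (a j)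
  have hlift : ∀ a i, (lift a).coeff i = if h : i < J then a ⟨i, h⟩ else 0 := by
    intro a i
    simp only [lift, finsetSum_coeff, coeff_monomial]
    split_ifs with h
    · rw [Finset.sum_eq_single ⟨i, h⟩]
      · simp
      · intro b _ hb
        rw [if_neg]
        rintro rfl
        exact hb rfl
      · simp
    · refine Finset.sum_eq_zero fun b _ => ?_
      rw [if_neg]
      rintro rfl
      exact h b.2
  have hleval : ∀ a, (lift a).eval (X ^ q₀) = ∑ j, a j * (X ^ q₀) ^ (j : ℕ) := by
    intro a
    simp [lift, eval_finsetSum, eval_monomial]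
  set H : K[X] := (lift α).eval (X ^ q₀) + f ^ e * (lift δ).eval (X ^ q₀) with hH
  have hH0 : H ≠ 0 := by
    intro hzero
    have := stepanov_independent hq₀ ⟨t, ht⟩ hf hf0 (P := lift α) (D := lift δ) ?_ ?_ hzero
    · have h1 := congrArg (fun R => R.coeff (j₀ : ℕ)) this.1
      have h2 := congrArg (fun R => R.coeff (j₀ : ℕ)) this.2
      simp [hlift] at h1 h2
      tauto
    · intro j
      rw [hlift]
      split_ifs with h
      · have := hα ⟨j, h⟩
        omega
      · simp; omega
    · intro j
      rw [hlift]
      split_ifs with h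
      · have := hδ ⟨j, h⟩
        omega
      · simp; omega
  have hHsum : H = ∑ j, (α j + f ^ e * δ j) * (X ^ q₀) ^ (j : ℕ) := by
    rw [hH, hleval, hleval, Finset.mul_sum, ← Finset.sum_add_distrib]
    exact Finset.sum_congr rfl fun j _ => by ring
  have hHdeg : H.natDegree ≤ (A + m * e) + (J - 1) * q₀ := by
    rw [hHsum]
    refine natDegree_sum_le_of_forall_le _ _ fun j _ => ?_
    refine natDegree_mul_le.trans (add_le_add ?_ ?_)
    · refine (natDegree_add_le _ _).trans (max_le ?_ ?_)
      · have := hα j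
        omega
      · refine natDegree_mul_le.trans ?_
        have := hδ j
        rw [natDegree_pow, mul_comm, ← hmdef]
        omega
    · rw [← pow_mul, natDegree_X_pow, mul_comm]
      exact Nat.mul_le_mul_right _ (by omega)
  have hroot : ∀ x, f.eval x ^ ((q₀ ^ 2 - 1) / 2) = θ → H.eval x = 0 := by
    intro x hx
    have hpos : 0 < q₀ := by omega
    refine (pow_eq_zero_iff hpos.ne').mp ?_
    have hxQ : x ^ (q₀ * q₀) = x := by
      rw [← sq, ← hK, FiniteField.pow_card]
    have hfx : f.eval x ^ (e * q₀) = θ * f.eval x ^ e := by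
      rw [← hx, ← pow_add]
      congr 1
      rw [he', ht]
      have : ((2 * t + 1) ^ 2 - 1) / 2 = 2 * t * t + 2 * t := by
        have : (2 * t + 1) ^ 2 = 2 * (2 * t * t + 2 * t) + 1 := by ring
        omega
      rw [this]; ring
    have h0 := congrArg (eval x) hsum
    rw [eval_zero, eval_finsetSum] at h0
    rw [← h0, hHsum, eval_finsetSum, hq₀, sum_pow_char_pow]
    refine Finset.sum_congr rfl fun j _ => ?_
    simp only [eval_mul, eval_add, eval_pow, eval_X, eval_C]
    have hxj : ((x ^ q₀) ^ (j : ℕ)) ^ q₀ = x ^ (j : ℕ) := by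
      rw [← pow_mul, ← pow_mul, mul_left_comm, mul_comm, pow_mul, hxQ]
    rw [mul_pow, add_pow_expChar_pow, mul_pow, ← hq₀, hxj, ← pow_mul (f.eval x), hfx]
  have hsub : #{x : K | f.eval x ^ ((q₀ ^ 2 - 1) / 2) = θ} ≤ H.natDegree := by
    refine le_trans ?_ (H.card_roots')
    refine le_trans (Finset.card_le_card ?_) (Multiset.toFinset_card_le _)
    intro x hx
    rw [Finset.mem_filter] at hx
    rw [Multiset.mem_toFinset, mem_roots hH0]
    exact hroot x hx.2
  have hfin : 2 * ((A + m * e) + (J - 1) * q₀) ≤ q₀ ^ 2 + (10 * m + 4) * q₀ := by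
    have h1 : A ≤ q₀ := by omega
    have h2 : m * e ≤ m * q₀ := Nat.mul_le_mul_left _ (by omega)
    have h3 : 2 * (J - 1) ≤ q₀ + 8 * m := by omega
    nlinarith [Nat.mul_le_mul_right q₀ h3]
  omega

section QuadraticCharacter

variable {K : Type*} [Field K] [Fintype K]

theorem sum_comp_sq (hK : ringChar K ≠ 2) (g : K → ℂ) :
    ∑ s, g (s ^ 2) = ∑ t, (1 + (quadraticChar K t : ℂ)) * g t := by
  rw [← Finset.sum_fiberwise (s := univ) (g := fun s : K => s ^ 2)]
  refine Finset.sum_congr rfl fun t _ => ?_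
  have h := quadraticChar_card_sqrts hK t
  rw [Finset.sum_congr rfl (g := fun _ => g t) fun x hx => by rw [(Finset.mem_filter.mp hx).2],
    Finset.sum_const, nsmul_eq_mul]
  congr 1
  rw [Set.toFinset_ofPred] at h
  rw [add_comm]
  exact_mod_cast h

theorem sum_comp_nonsquare_mul_sq (hK : ringChar K ≠ 2) {ν : K} (hν : ¬ IsSquare ν) (g : K → ℂ) :
    ∑ s, g (ν * s ^ 2) = ∑ t, (1 - (quadraticChar K t : ℂ)) * g t := by
  have hν0 : ν ≠ 0 := by rintro rfl; exact hν (IsSquare.zero)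
  rw [sum_comp_sq hK (fun t => g (ν * t)),
    ← Equiv.sum_comp (Equiv.mulLeft₀ ν hν0) (fun t => (1 - (quadraticChar K t : ℂ)) * g t)]
  refine Finset.sum_congr rfl fun t _ => ?_
  have : quadraticChar K ν = -1 := quadraticChar_neg_one_iff_not_isSquare.mpr hν
  rw [Equiv.mulLeft₀_apply, map_mul, this]
  push_cast
  ring

theorem sum_comp_add_mul_inv (hK : ringChar K ≠ 2) {a : K} (ha : a ≠ 0) (g : K → ℂ) :
    ∑ x, (if x = 0 then 0 else g (x + a * x⁻¹)) =
      ∑ t, (1 + (quadraticChar K (t ^ 2 - 4 * a) : ℂ)) * g t := by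
  have h2 : (2 : K) ≠ 0 := Ring.two_ne_zero hK
  have h4 : (4 : K) ≠ 0 := by
    rw [show (4 : K) = 2 * 2 by norm_num]; exact mul_ne_zero h2 h2
  have hflip : ∀ x : K, (if x = 0 then 0 else g (x + a * x⁻¹)) =
      ∑ t, if (2 * x - t) ^ 2 = t ^ 2 - 4 * a then g t else 0 := by
    intro x
    have hiff : ∀ t, (2 * x - t) ^ 2 = t ^ 2 - 4 * a ↔ x * t = x ^ 2 + a := by
      intro t
      constructor
      · intro h
        apply mul_left_cancel₀ h4
        linear_combination -h
      · intro h
        linear_combination -4 * h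
    simp only [hiff]
    split_ifs with hx
    · subst hx
      refine (Finset.sum_eq_zero fun t _ => if_neg ?_).symm
      intro h
      apply ha
      linear_combination -h
    · rw [Finset.sum_eq_single (x + a * x⁻¹)]
      · rw [if_pos]
        field_simp
      · intro t _ ht
        rw [if_neg]
        intro h
        apply ht
        field_simp
        linear_combination h
      · simp
  simp only [hflip]
  rw [Finset.sum_comm]
  refine Finset.sum_congr rfl fun t _ => ?_
  have h := quadraticChar_card_sqrts hK (t ^ 2 - 4 * a)
  rw [Set.toFinset_ofPred] at h
  rw [← Finset.sum_filter, Finset.sum_const, nsmul_eq_mul]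
  congr 1
  rw [add_comm]
  have hc : #{x : K | (2 * x - t) ^ 2 = t ^ 2 - 4 * a} = #{x : K | x ^ 2 = t ^ 2 - 4 * a} := by
    refine Finset.card_bij (fun x _ => 2 * x - t) ?_ ?_ ?_
    · intro x hx
      simpa using hx
    · intro x _ y _ hxy
      exact mul_left_cancel₀ h2 (sub_left_injective hxy)
    · intro y hy
      refine ⟨(y + t) / 2, ?_, ?_⟩
      · rw [Finset.mem_filter] at hy ⊢
        refine ⟨mem_univ _, ?_⟩
        rw [← hy.2]
        congr 1
        field_simp
        ring
      · field_simp
        ring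
  rw [hc]
  exact_mod_cast h

/-- The Kloosterman sum `∑ ψ(x + a / x)` over nonzero `x`. -/
noncomputable def kloostermanSum (ψ : AddChar K ℂ) (a : K) : ℂ :=
  ∑ x, if x = 0 then 0 else ψ (x + a * x⁻¹)

theorem conj_kloostermanSum (ψ : AddChar K ℂ) (a : K) :
    (starRingEnd ℂ) (kloostermanSum ψ a) = kloostermanSum ψ a := by
  rw [kloostermanSum, map_sum, ← Equiv.sum_comp (Equiv.neg K)]
  refine Finset.sum_congr rfl fun x _ => ?_
  simp only [Equiv.neg_apply, neg_eq_zero]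
  split_ifs with h
  · simp
  · rw [← AddChar.map_neg_eq_conj]
    congr 1
    rw [inv_neg]
    ring

theorem kloostermanSum_eq_sum_quadraticChar (hK : ringChar K ≠ 2) {ψ : AddChar K ℂ} (hψ : ψ ≠ 1)
    {a : K} (ha : a ≠ 0) :
    kloostermanSum ψ a = ∑ t, (quadraticChar K (t ^ 2 - 4 * a) : ℂ) * ψ t := by
  rw [kloostermanSum, sum_comp_add_mul_inv hK ha (fun t => ψ t)]
  simp only [add_mul, one_mul]
  rw [Finset.sum_add_distrib, AddChar.sum_eq_zero_of_ne_one hψ, zero_add]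

theorem sum_quadraticChar_sq_sub (hK : ringChar K ≠ 2) {a : K} (ha : a ≠ 0) :
    ∑ t : K, (quadraticChar K (t ^ 2 - 4 * a) : ℂ) = -1 := by
  have h := sum_comp_add_mul_inv hK ha (fun _ => 1)
  simp only [mul_one] at h
  rw [Finset.sum_add_distrib, Finset.sum_ite, Finset.sum_const_zero, zero_add, Finset.sum_const,
    Finset.sum_const, Finset.filter_ne', Finset.card_erase_of_mem (mem_univ _), nsmul_eq_mul,
    nsmul_eq_mul, Nat.cast_sub (Finset.card_pos.mpr ⟨0, mem_univ _⟩)] at h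
  push_cast at h
  linear_combination -h

theorem sum_one_add_mul_inv_eq {ψ : AddChar K ℂ} (hK : ringChar K ≠ 2) (hψ : ψ ≠ 1)
    {a : K} (ha : a ≠ 0) :
    ∑ r : K, ∑ v : K, (if v = 0 then 0 else ψ (2 * r + a * (2 * r) * v⁻¹)) =
      (Fintype.card K : ℂ) := by
  have h2 : (2 : K) ≠ 0 := Ring.two_ne_zero hK
  rw [Finset.sum_comm, Finset.sum_eq_single (-a)]
  · rw [Finset.sum_congr rfl (g := fun _ => 1), Finset.sum_const, nsmul_eq_mul, mul_one,
      Finset.card_univ]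
    intro r _
    rw [if_neg (neg_ne_zero.mpr ha)]
    have : 2 * r + a * (2 * r) * (-a)⁻¹ = 0 := by
      rw [inv_neg]; field_simp; ring
    rw [this, AddChar.map_zero_eq_one]
  · intro v _ hv
    split_ifs with h0
    · simp
    have hc : 2 * (1 + a * v⁻¹) ≠ 0 := by
      refine mul_ne_zero h2 fun h => hv ?_
      field_simp at h
      linear_combination h
    rw [← AddChar.sum_eq_zero_of_ne_one hψ,
      ← Equiv.sum_comp (Equiv.mulLeft₀ _ hc) (fun t => ψ t)]
    refine Finset.sum_congr rfl fun r _ => ?_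
    rw [Equiv.mulLeft₀_apply]
    congr 1
    ring
  · simp

theorem kloostermanSum_sq (hK : ringChar K ≠ 2) (ψ : AddChar K ℂ) (a : K) :
    kloostermanSum ψ a ^ 2 = ∑ r : K, ∑ s : K,
      if r ^ 2 - s ^ 2 = 0 then 0 else ψ (2 * r + a * (2 * r) * (r ^ 2 - s ^ 2)⁻¹) := by
  have h2 : (2 : K) ≠ 0 := Ring.two_ne_zero hK
  rw [sq, kloostermanSum, Finset.sum_mul_sum, ← Fintype.sum_prod_type', ← Fintype.sum_prod_type']
  symm
  refine Fintype.sum_bijective (fun z : K × K => (z.1 + z.2, z.1 - z.2)) ?_ _ _ ?_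
  · rw [Function.bijective_iff_has_inverse]
    refine ⟨fun z => ((z.1 + z.2) / 2, (z.1 - z.2) / 2), ?_, ?_⟩
    · rintro ⟨x, y⟩
      ext <;> simp <;> field_simp <;> ring
    · rintro ⟨x, y⟩
      ext <;> simp <;> field_simp <;> ring
  · rintro ⟨r, s⟩
    dsimp only
    have hfac : r ^ 2 - s ^ 2 = (r + s) * (r - s) := by ring
    rw [hfac]
    by_cases h1 : r + s = 0
    · simp [h1]
    by_cases h3 : r - s = 0
    · simp [h3]
    rw [if_neg h1, if_neg h3, if_neg (mul_ne_zero h1 h3), ← AddChar.map_add_eq_mul]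
    congr 1
    field_simp
    ring

instance QuadraticAlgebra.instFintype (ν b : K) : Fintype (QuadraticAlgebra K ν b) :=
  Fintype.ofEquiv _ (QuadraticAlgebra.linearEquivTuple ν b).symm.toEquiv

theorem QuadraticAlgebra.sum_eq (ν b : K) (g : QuadraticAlgebra K ν b → ℂ) :
    ∑ z, g z = ∑ r : K, ∑ s : K, g ⟨r, s⟩ := by
  rw [← Fintype.sum_prod_type']
  symm
  refine Fintype.sum_bijective (fun x : K × K => (⟨x.1, x.2⟩ : QuadraticAlgebra K ν b)) ?_ _ _
    fun _ => rfl
  rw [Function.bijective_iff_has_inverse]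
  exact ⟨fun z => (z.re, z.im), fun _ => rfl, fun _ => rfl⟩

theorem kloostermanSum_quadraticAlgebra (hK : ringChar K ≠ 2) {ψ : AddChar K ℂ} (hψ : ψ ≠ 1)
    {a : K} (ha : a ≠ 0) {ν : K} [Fact (∀ r : K, r ^ 2 ≠ ν + 0 * r)] (hν : ¬ IsSquare ν) :
    kloostermanSum (ψ.compAddMonoidHom
        (QuadraticAlgebra.trace (R := K) (a := ν) (b := 0)).toAddMonoidHom)
      (algebraMap K (QuadraticAlgebra K ν 0) a) =
      2 * Fintype.card K - kloostermanSum ψ a ^ 2 := by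
  rw [kloostermanSum_sq hK, kloostermanSum, QuadraticAlgebra.sum_eq, eq_sub_iff_add_eq,
    ← sum_one_add_mul_inv_eq hK hψ ha, ← Finset.sum_add_distrib, Finset.mul_sum]
  refine Finset.sum_congr rfl fun r _ => ?_
  let g : K → ℂ := fun t => if r ^ 2 - t = 0 then 0 else
    ψ (2 * r + a * (2 * r) * (r ^ 2 - t)⁻¹)
  trans (∑ s, g (ν * s ^ 2)) + ∑ s, g (s ^ 2)
  · refine congrArg (· + _) (Finset.sum_congr rfl fun s _ => ?_)
    have hn : QuadraticAlgebra.norm (⟨r, s⟩ : QuadraticAlgebra K ν 0) = r ^ 2 - ν * s ^ 2 := by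
      rw [QuadraticAlgebra.norm_def]; ring
    have hz : (⟨r, s⟩ : QuadraticAlgebra K ν 0) = 0 ↔ r ^ 2 - ν * s ^ 2 = 0 := by
      rw [← hn, QuadraticAlgebra.norm_eq_zero_iff_eq_zero]
    simp only [g, hz]
    congr 1
    rw [AddChar.compAddMonoidHom_apply]
    congr 1
    simp only [LinearMap.toAddMonoidHom_coe, QuadraticAlgebra.trace_def]
    simp [QuadraticAlgebra.re_inv, hn]
    ring
  have h2 : ∑ v : K, (if v = 0 then (0 : ℂ) else ψ (2 * r + a * (2 * r) * v⁻¹)) = ∑ t, g t := by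
    rw [← Equiv.sum_comp (Equiv.subLeft (r ^ 2))]
    rfl
  rw [h2, sum_comp_nonsquare_mul_sq hK hν, sum_comp_sq hK g, ← Finset.sum_add_distrib,
    Finset.mul_sum]
  refine Finset.sum_congr rfl fun t _ => ?_
  ring

end QuadraticCharacter

section Tower

/-- The iteration governing Kloosterman sums along a tower of quadratic extensions. -/
noncomputable def kloostermanIter (q : ℕ) (x : ℝ) : ℕ → ℝ
  | 0 => x
  | s + 1 => 2 * (q : ℝ) ^ 2 ^ s - kloostermanIter q x s ^ 2

theorem ringChar_ne_two_of_odd_card {K : Type*} [Field K] [Fintype K] (h : Odd (Fintype.card K)) :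
    ringChar K ≠ 2 := by
  intro h2
  have := FiniteField.even_card_iff_char_two.mp h2
  rw [Nat.odd_iff] at h
  omega

theorem QuadraticAlgebra.trace_pow_expChar_pow {K : Type*} [Field K] (ν : K)
    (p f : ℕ) [CharP K p] [Fact p.Prime] [Fact (∀ r : K, r ^ 2 ≠ ν + 0 * r)]
    (z : QuadraticAlgebra K ν 0) :
    QuadraticAlgebra.trace (z ^ p ^ f) = (QuadraticAlgebra.trace z) ^ p ^ f := by
  have : CharP (QuadraticAlgebra K ν 0) p :=
    charP_of_injective_algebraMap (algebraMap K (QuadraticAlgebra K ν 0)).injective p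
  apply (algebraMap K (QuadraticAlgebra K ν 0)).injective
  rw [RingHom.map_pow, QuadraticAlgebra.algebraMap_trace_eq_add_star,
    QuadraticAlgebra.algebraMap_trace_eq_add_star, star_pow, add_pow_char_pow]

theorem exists_quadratic_tower {k : Type} [Field k] [Fintype k] (hk : Odd (Fintype.card k))
    (s : ℕ) :
    ∃ (K : Type) (_ : Field K) (_ : Fintype K) (φ : k →+* K) (τ : K →+ k),
      Fintype.card K = Fintype.card k ^ 2 ^ s ∧ Function.Surjective τ ∧
      (∀ y, τ (y ^ Fintype.card k) = τ y) ∧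
      ∀ ψ : AddChar k ℂ, ψ ≠ 1 → ∀ a : k, a ≠ 0 →
        kloostermanSum (ψ.compAddMonoidHom τ) (φ a) =
          (kloostermanIter (Fintype.card k) (kloostermanSum ψ a).re s : ℂ) := by
  induction s with
  | zero =>
    refine ⟨k, inferInstance, inferInstance, RingHom.id k, AddMonoidHom.id k, by simp,
      Function.surjective_id, fun y => ?_, fun ψ _ a _ =>
        (Complex.conj_eq_iff_re.mp (conj_kloostermanSum ψ a)).symm⟩
    rw [FiniteField.pow_card]
  | succ s ih =>
    obtain ⟨K, _, _, φ, τ, hcard, hsurj, hfrob, hkl⟩ := ih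
    have hKodd : Odd (Fintype.card K) := by rw [hcard]; exact hk.pow
    have hK := ringChar_ne_two_of_odd_card hKodd
    have h2 : (2 : K) ≠ 0 := Ring.two_ne_zero hK
    obtain ⟨ν, hν⟩ := FiniteField.exists_nonsquare hK
    have : Fact (∀ r : K, r ^ 2 ≠ ν + 0 * r) :=
      ⟨fun r h => hν ⟨r, by linear_combination -h⟩⟩
    refine ⟨QuadraticAlgebra K ν 0, inferInstance, inferInstance,
      (algebraMap K (QuadraticAlgebra K ν 0)).comp φ,
      τ.comp (QuadraticAlgebra.trace (R := K) (a := ν) (b := 0)).toAddMonoidHom,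
      ?_, ?_, ?_, ?_⟩
    · rw [← Nat.card_eq_fintype_card, Nat.card_congr (QuadraticAlgebra.linearEquivTuple ν 0).toEquiv,
        Nat.card_eq_fintype_card, Fintype.card_fun, hcard, ← pow_mul, pow_succ, Fintype.card_fin]
    · refine hsurj.comp fun r => ⟨⟨r / 2, 0⟩, ?_⟩
      simp only [LinearMap.toAddMonoidHom_coe, QuadraticAlgebra.trace_def]
      field_simp
      ring
    · intro y
      obtain ⟨p, hp⟩ := CharP.exists k
      obtain ⟨f, hprime, hf⟩ := FiniteField.card k p
      have : Fact p.Prime := ⟨hprime⟩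
      have : CharP K p := charP_of_injective_ringHom φ.injective p
      have := QuadraticAlgebra.trace_pow_expChar_pow ν p f y
      rw [← hf] at this
      simp only [AddMonoidHom.comp_apply, LinearMap.toAddMonoidHom_coe, this, hfrob]
    · intro ψ hψ a ha
      have hψ' : ψ.compAddMonoidHom τ ≠ 1 := by
        intro h
        apply hψ
        ext x
        obtain ⟨y, rfl⟩ := hsurj x
        have := DFunLike.congr_fun h y
        simpa using this
      have := kloostermanSum_quadraticAlgebra hK hψ' ((map_ne_zero φ).mpr ha) hν
      rw [hkl ψ hψ a ha, hcard] at this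
      rw [kloostermanIter]
      push_cast at this ⊢
      exact this

end Tower

section ArtinSchreier

theorem sum_comp_of_range_eq_ker {G k : Type*} [AddCommGroup G] [Fintype G] [AddCommGroup k]
    [Fintype k] {δ : G →+ G} {τ : G →+ k} (hτ : Function.Surjective τ) (hδτ : ∀ y, τ (δ y) = 0)
    (hδ : Nat.card δ.ker ≤ Fintype.card k) (g : G → ℂ) :
    ∑ y, g (δ y) = Fintype.card k * ∑ t, if τ t = 0 then g t else 0 := by
  have h1 : Nat.card τ.ker * Fintype.card k = Nat.card G := by
    rw [← AddSubgroup.card_mul_index τ.ker, AddSubgroup.index_ker,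
      AddMonoidHom.range_eq_top.mpr hτ, AddSubgroup.card_top, Nat.card_eq_fintype_card (α := k)]
  have h2 : Nat.card δ.ker * Nat.card δ.range = Nat.card G := by
    rw [← AddSubgroup.card_mul_index δ.ker, AddSubgroup.index_ker]
  have hpos : 0 < Fintype.card k := Fintype.card_pos_iff.mpr ⟨0⟩
  have hle : δ.range ≤ τ.ker := by
    rintro _ ⟨y, rfl⟩
    exact hδτ y
  have hcard : Nat.card τ.ker ≤ Nat.card δ.range := by
    refine Nat.le_of_mul_le_mul_right ?_ hpos
    rw [h1, ← h2, mul_comm]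
    exact Nat.mul_le_mul_left _ hδ
  have heq : δ.range = τ.ker := AddSubgroup.eq_of_le_of_card_ge hle hcard
  have hker : Nat.card δ.ker = Fintype.card k := by
    rw [heq, ← h1, mul_comm] at h2
    exact Nat.eq_of_mul_eq_mul_left Nat.card_pos h2
  rw [← Finset.sum_fiberwise (s := univ) (g := δ), Finset.mul_sum]
  refine Finset.sum_congr rfl fun t _ => ?_
  rw [Finset.sum_congr rfl (g := fun _ => g t) fun x hx => by rw [(Finset.mem_filter.mp hx).2],
    Finset.sum_const, nsmul_eq_mul]
  split_ifs with ht
  · congr 2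
    have hmem : t ∈ δ.range := by rw [heq]; exact ht
    rw [AddMonoidHom.card_fiber_eq_of_mem_range δ (y := 0) hmem ⟨0, map_zero δ⟩, ← hker,
      Nat.card_eq_fintype_card, Fintype.card_subtype]
    simp only [AddMonoidHom.mem_ker]
  · have hempty : ({y : G | δ y = t} : Finset G) = ∅ :=
      Finset.filter_eq_empty_iff.mpr fun y _ hy => ht (hy ▸ hδτ y)
    simp [hempty]

open Polynomial in
theorem sum_comp_pow_card_sub {k K : Type*} [Field k] [Fintype k] [Field K] [Fintype K]
    (φ : k →+* K) {τ : K →+ k} (hτ : Function.Surjective τ)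
    (hfrob : ∀ y, τ (y ^ Fintype.card k) = τ y) (g : K → ℂ) :
    ∑ y : K, g (y ^ Fintype.card k - y) = ∑ ψ : AddChar k ℂ, ∑ t, ψ (τ t) * g t := by
  obtain ⟨p, hp⟩ := CharP.exists k
  obtain ⟨f, hprime, hf⟩ := FiniteField.card k p
  have : Fact p.Prime := ⟨hprime⟩
  have : CharP K p := charP_of_injective_ringHom φ.injective p
  let δ : K →+ K := (iterateFrobenius K p f).toAddMonoidHom - AddMonoidHom.id K
  have hδ : ∀ y, δ y = y ^ Fintype.card k - y := by
    intro y
    rw [hf]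
    rfl
  have hcard : 1 < Fintype.card k := Fintype.one_lt_card
  have hker : Nat.card δ.ker ≤ Fintype.card k := by
    rw [Nat.card_eq_fintype_card, Fintype.card_subtype,
      ← FiniteField.X_pow_card_sub_X_natDegree_eq K hcard]
    refine Polynomial.card_le_degree_of_subset_roots fun y hy => ?_
    have hy' : δ y = 0 := by simpa using hy
    rw [hδ] at hy'
    rw [Polynomial.mem_roots (FiniteField.X_pow_card_sub_X_ne_zero K hcard)]
    simpa using hy'
  have h := sum_comp_of_range_eq_ker (δ := δ) hτ
    (fun y => by rw [hδ, map_sub, hfrob, sub_self]) hker g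
  simp only [hδ] at h
  rw [h, Finset.sum_comm, Finset.mul_sum]
  refine Finset.sum_congr rfl fun t _ => ?_
  rw [← Finset.sum_mul, AddChar.sum_apply_eq_ite]
  split_ifs <;> simp

theorem sum_quadraticChar_eq_sum_kloostermanSum {k K : Type*} [Field k] [Fintype k] [Field K]
    [Fintype K] (hK : ringChar K ≠ 2) (φ : k →+* K) {τ : K →+ k} (hτ : Function.Surjective τ)
    (hfrob : ∀ y, τ (y ^ Fintype.card k) = τ y) {b : K} (hb : b ≠ 0) :
    ∑ y : K, (quadraticChar K ((y ^ Fintype.card k - y) ^ 2 - 4 * b) : ℂ) =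
      -1 + ∑ ψ ∈ (univ : Finset (AddChar k ℂ)).erase 1,
        kloostermanSum (ψ.compAddMonoidHom τ) b := by
  rw [sum_comp_pow_card_sub φ hτ hfrob (fun t => (quadraticChar K (t ^ 2 - 4 * b) : ℂ)),
    ← Finset.add_sum_erase univ _ (mem_univ 1)]
  congr 1
  · rw [← sum_quadraticChar_sq_sub hK hb]
    simp
  · refine Finset.sum_congr rfl fun ψ hψ => ?_
    rw [kloostermanSum_eq_sum_quadraticChar hK _ hb]
    · refine Finset.sum_congr rfl fun t _ => ?_
      rw [mul_comm]
      rfl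
    · intro h
      refine Finset.ne_of_mem_erase hψ ?_
      ext x
      obtain ⟨y, rfl⟩ := hτ x
      have := DFunLike.congr_fun h y
      simpa using this

open Polynomial in
theorem neg_le_sum_quadraticChar {K : Type*} [Field K] [Fintype K] {p r q₀ : ℕ} [ExpChar K p]
    (hq₀ : q₀ = p ^ r) (hodd : Odd q₀) (hcard : Fintype.card K = q₀ ^ 2) {f : K[X]}
    (hf : Squarefree f) (hpos : 0 < f.natDegree) (hdeg : 8 * f.natDegree ≤ q₀) :
    -(f.natDegree + (10 * f.natDegree + 4) * q₀ : ℝ) ≤ ∑ y : K, (quadraticChar K (f.eval y) : ℝ) := by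
  have hKodd : Odd (Fintype.card K) := by rw [hcard]; exact hodd.pow
  have hK := ringChar_ne_two_of_odd_card hKodd
  have hS := two_mul_card_eval_pow_eq_le hq₀ hodd hcard hf hpos hdeg (-1)
  have hhalf : (q₀ ^ 2 - 1) / 2 = Fintype.card K / 2 := by
    rw [hcard] at hKodd ⊢
    obtain ⟨m, hm⟩ := hKodd
    omega
  have hne : (1 : K) ≠ -1 := by
    intro h
    apply Ring.two_ne_zero hK
    linear_combination h
  have hneg : ∀ x : K, x ^ ((q₀ ^ 2 - 1) / 2) = -1 ↔ quadraticChar K x = -1 := by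
    intro x
    have hx := quadraticChar_eq_pow_of_char_ne_two' hK x
    rw [hhalf, ← hx]
    constructor
    · intro h
      by_cases h0 : x = 0
      · subst h0
        simp at h
      rcases quadraticChar_dichotomy h0 with h1 | h1
      · rw [h1] at h
        simp only [Int.cast_one] at h
        exact absurd h hne
      · exact h1
    · intro h
      rw [h]
      simp
  simp only [hneg] at hS
  have hroots : #{y : K | f.eval y = 0} ≤ f.natDegree := by
    refine Polynomial.card_le_degree_of_subset_roots fun y hy => ?_
    rw [Polynomial.mem_roots hf.ne_zero]
    simpa using hy
  have hval : ∀ y : K, (quadraticChar K (f.eval y) : ℝ) = 1 - (if f.eval y = 0 then 1 else 0) -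
      2 * (if quadraticChar K (f.eval y) = -1 then 1 else 0) := by
    intro y
    by_cases h0 : f.eval y = 0
    · simp [h0]
    rcases quadraticChar_dichotomy h0 with h1 | h1
    · rw [h1, if_neg h0]; norm_num
    · rw [h1, if_neg h0]; norm_num
  rw [Finset.sum_congr rfl fun y _ => hval y, Finset.sum_sub_distrib, Finset.sum_sub_distrib,
    ← Finset.mul_sum, Finset.sum_boole, Finset.sum_boole, Finset.sum_const, nsmul_eq_mul, mul_one,
    Finset.card_univ, hcard]
  have hS' : (2 * #{y : K | quadraticChar K (f.eval y) = -1} : ℝ) ≤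
      (q₀ : ℝ) ^ 2 + (10 * f.natDegree + 4) * q₀ := by exact_mod_cast hS
  have hr' : (#{y : K | f.eval y = 0} : ℝ) ≤ f.natDegree := by exact_mod_cast hroots
  push_cast
  linarith

open Polynomial in
theorem squarefree_sq_sub_C {K : Type*} [Field K] [Fintype K] (hK : ringChar K ≠ 2) {q : ℕ}
    (hq : (q : K) = 0) {b : K} (hb : b ≠ 0) :
    Squarefree ((X ^ q - X : K[X]) ^ 2 - C (4 * b)) := by
  have h2 : (2 : K) ≠ 0 := Ring.two_ne_zero hK
  apply Polynomial.Separable.squarefree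
  refine ⟨-C (4 * b)⁻¹, -C (8 * b)⁻¹ * (X ^ q - X), ?_⟩
  have h4 : C (4 * b)⁻¹ * C (4 * b) = (1 : K[X]) := by
    rw [← C_mul, inv_mul_cancel₀, C_1]
    refine mul_ne_zero ?_ hb
    rw [show (4 : K) = 2 * 2 by norm_num]; exact mul_ne_zero h2 h2
  have h8 : C (4 * b)⁻¹ = (2 * C (8 * b)⁻¹ : K[X]) := by
    rw [show (2 : K[X]) = C 2 from rfl, ← C_mul]
    congr 1
    rw [show (8 : K) = 2 * 4 by norm_num, mul_assoc, mul_inv (2 : K), ← mul_assoc,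
      mul_inv_cancel₀ h2, one_mul]
  have hd : derivative ((X ^ q - X : K[X]) ^ 2 - C (4 * b)) = -2 * (X ^ q - X) := by
    simp only [derivative_sub, derivative_C, derivative_sq, derivative_X_pow, hq, derivative_X]
    simp only [map_zero, zero_mul, zero_sub, sub_zero, map_ofNat]
    ring
  rw [hd]
  linear_combination h4 - (X ^ q - X) ^ 2 * h8

end ArtinSchreier

section KloostermanBound

theorem kloostermanIter_succ_le (q : ℕ) (x : ℝ) (s : ℕ) :
    kloostermanIter q x (s + 1) ≤ 2 * (q : ℝ) ^ 2 ^ s := by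
  rw [kloostermanIter]
  nlinarith [sq_nonneg (kloostermanIter q x s)]

theorem kloostermanIter_succ_le_of_sq_eq {q : ℕ} {x δ : ℝ} (hδ : 0 ≤ δ)
    (hx : (4 + δ) * q ≤ x ^ 2) (s : ℕ) :
    kloostermanIter q x (s + 1) ≤ -((2 + 4 ^ s * δ) * (q : ℝ) ^ 2 ^ s) := by
  induction s with
  | zero =>
    rw [kloostermanIter, kloostermanIter]
    norm_num
    linarith
  | succ s ih =>
    rw [kloostermanIter]
    have h0 : 0 ≤ (2 + 4 ^ s * δ) * (q : ℝ) ^ 2 ^ s := by positivity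
    have h1 : ((2 + 4 ^ s * δ) * (q : ℝ) ^ 2 ^ s) ^ 2 ≤ kloostermanIter q x (s + 1) ^ 2 := by
      rw [← neg_sq (kloostermanIter q x (s + 1))]
      exact pow_le_pow_left₀ h0 (by linarith) 2
    have h2 : ((q : ℝ) ^ 2 ^ s) ^ 2 = (q : ℝ) ^ 2 ^ (s + 1) := by
      rw [← pow_mul, ← pow_succ]
    rw [mul_pow, h2] at h1
    have h3 : 0 ≤ (4 ^ s * δ) ^ 2 * (q : ℝ) ^ 2 ^ (s + 1) := by positivity
    have h4 : (2 + 4 ^ s * δ) ^ 2 * (q : ℝ) ^ 2 ^ (s + 1) =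
      (4 + 4 ^ (s + 1) * δ) * (q : ℝ) ^ 2 ^ (s + 1) + (4 ^ s * δ) ^ 2 * (q : ℝ) ^ 2 ^ (s + 1) := by
      ring
    linarith

open Polynomial in
theorem neg_le_sum_kloostermanIter {k : Type} [Field k] [Fintype k]
    (hk : Odd (Fintype.card k)) {a : k} (ha : a ≠ 0) {s : ℕ}
    (hs : 16 * Fintype.card k ≤ Fintype.card k ^ 2 ^ s) :
    -(22 * Fintype.card k + 4 : ℝ) * Fintype.card k ^ 2 ^ s ≤
      ∑ ψ ∈ (univ : Finset (AddChar k ℂ)).erase 1,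
        kloostermanIter (Fintype.card k) (kloostermanSum ψ a).re (s + 1) := by
  obtain ⟨K, _, _, φ, τ, hcard, hsurj, hfrob, hkl⟩ := exists_quadratic_tower hk (s + 1)
  have hKodd : Odd (Fintype.card K) := by rw [hcard]; exact hk.pow
  have hK := ringChar_ne_two_of_odd_card hKodd
  have h2 : (2 : K) ≠ 0 := Ring.two_ne_zero hK
  have hb : φ a ≠ 0 := (map_ne_zero φ).mpr ha
  obtain ⟨p, hp⟩ := CharP.exists k
  obtain ⟨f, hprime, hf⟩ := FiniteField.card k p
  have : Fact p.Prime := ⟨hprime⟩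
  have : CharP K p := charP_of_injective_ringHom φ.injective p
  have hq0 : ((Fintype.card k : ℕ) : K) = 0 := by
    rw [← map_natCast φ, FiniteField.cast_card_eq_zero, map_zero]
  set q := Fintype.card k with hq
  have hq1 : 1 < q := Fintype.one_lt_card
  set F : K[X] := (X ^ q - X) ^ 2 - C (4 * φ a) with hF
  have hdeg : F.natDegree = 2 * q := by
    rw [hF, natDegree_sub_C, natDegree_pow, FiniteField.X_pow_card_sub_X_natDegree_eq K hq1]
  have hT := neg_le_sum_quadraticChar (p := p) (r := f * 2 ^ s) (q₀ := q ^ 2 ^ s)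
    (by rw [hf, pow_mul]) hk.pow (by rw [hcard, ← pow_mul, ← pow_succ])
    (squarefree_sq_sub_C hK hq0 hb) (by rw [hdeg]; omega) (by rw [hdeg]; omega)
  have hsum := sum_quadraticChar_eq_sum_kloostermanSum hK φ hsurj hfrob hb
  rw [Finset.sum_congr rfl fun ψ hψ => hkl ψ (Finset.ne_of_mem_erase hψ) a ha] at hsum
  have hsum' : (∑ y : K, (quadraticChar K (F.eval y) : ℝ)) =
      -1 + ∑ ψ ∈ (univ : Finset (AddChar k ℂ)).erase 1,
        kloostermanIter q (kloostermanSum ψ a).re (s + 1) := by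
    rw [← Complex.ofReal_inj]
    push_cast
    rw [← hsum]
    simp [hF, hq]
  rw [← hF, hsum', hdeg] at hT
  have h1 : (1 : ℝ) ≤ (q : ℝ) ^ 2 ^ s := one_le_pow₀ (by exact_mod_cast hq1.le)
  have h3 : 0 ≤ (q : ℝ) * ((q : ℝ) ^ 2 ^ s - 1) := mul_nonneg (by positivity) (by linarith)
  push_cast at hT
  linarith

/-- The Kloosterman case of the Weil bound. -/
theorem norm_kloostermanSum_le {k : Type} [Field k] [Fintype k]
    (hk : Odd (Fintype.card k)) {ψ : AddChar k ℂ} (hψ : ψ ≠ 1) {a : k} (ha : a ≠ 0) :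
    ‖kloostermanSum ψ a‖ ≤ 2 * √(Fintype.card k) := by
  have hre := Complex.conj_eq_iff_re.mp (conj_kloostermanSum ψ a)
  rw [← hre, Complex.norm_real, Real.norm_eq_abs]
  apply abs_le_of_sq_le_sq _ (by positivity)
  rw [mul_pow, Real.sq_sqrt (by positivity)]
  by_contra! hlt
  set q := Fintype.card k with hq
  have hq3 : 3 ≤ q := by
    have : 1 < q := Fintype.one_lt_card
    obtain ⟨m, hm⟩ := hk
    omega
  have hqpos : (0 : ℝ) < q := by positivity
  set x := (kloostermanSum ψ a).re with hx
  set δ := x ^ 2 / q - 4 with hδ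
  have hδpos : 0 < δ := by
    rw [hδ, sub_pos, lt_div_iff₀ hqpos]
    linarith
  have hδx : (4 + δ) * q ≤ x ^ 2 := by
    rw [hδ]
    field_simp
    linarith
  obtain ⟨n, hn⟩ := pow_unbounded_of_one_lt ((24 * q + 2) / δ) (show (1 : ℝ) < 4 by norm_num)
  set s := n + 2 with hs
  have hs16 : 16 * q ≤ q ^ 2 ^ s := by
    have h4 : 4 ≤ 2 ^ s := by
      rw [hs, pow_add]
      have := Nat.one_le_two_pow (n := n)
      omega
    calc 16 * q ≤ 3 ^ 3 * q := by omega
      _ ≤ q ^ 3 * q := Nat.mul_le_mul_right _ (Nat.pow_le_pow_left hq3 3)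
      _ = q ^ 4 := by ring
      _ ≤ q ^ 2 ^ s := Nat.pow_le_pow_right (by omega) h4
  have hlow := neg_le_sum_kloostermanIter hk ha hs16
  have hmem : ψ ∈ (univ : Finset (AddChar k ℂ)).erase 1 := by simp [hψ]
  rw [← Finset.add_sum_erase _ _ hmem] at hlow
  have hψle := kloostermanIter_succ_le_of_sq_eq hδpos.le hδx s
  have hrest : ∑ χ ∈ ((univ : Finset (AddChar k ℂ)).erase 1).erase ψ,
      kloostermanIter q (kloostermanSum χ a).re (s + 1) ≤ q * (2 * (q : ℝ) ^ 2 ^ s) := by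
    refine (Finset.sum_le_card_nsmul _ _ _ fun χ _ => kloostermanIter_succ_le q _ s).trans ?_
    rw [nsmul_eq_mul]
    refine mul_le_mul_of_nonneg_right ?_ (by positivity)
    have h1 : #(((univ : Finset (AddChar k ℂ)).erase 1).erase ψ) ≤ q := by
      rw [hq, ← AddChar.card_eq (α := k)]
      exact Finset.card_le_univ _
    exact_mod_cast h1
  have hbig : 24 * (q : ℝ) + 2 < 4 ^ s * δ := by
    rw [div_lt_iff₀ hδpos] at hn
    refine hn.trans_le (mul_le_mul_of_nonneg_right ?_ hδpos.le)
    exact pow_le_pow_right₀ (by norm_num) (by omega)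
  have hQ : (0 : ℝ) < (q : ℝ) ^ 2 ^ s := by positivity
  nlinarith

end KloostermanBound

section SalieSum

variable {K : Type*} [Field K] [Fintype K]

theorem AddChar.sum_apply_mul_eq_ite {ψ : AddChar K ℂ} (hψ : ψ ≠ 1) (b : K) :
    ∑ x, ψ (x * b) = if b = 0 then (Fintype.card K : ℂ) else 0 := by
  rw [AddChar.sum_mulShift b (AddChar.IsPrimitive.of_ne_one hψ)]
  split_ifs <;> simp

theorem AddChar.sum_erase_zero_apply_mul_eq {ψ : AddChar K ℂ} (hψ : ψ ≠ 1) (b : K) :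
    ∑ x, (if x = 0 then 0 else ψ (x * b)) = (if b = 0 then (Fintype.card K : ℂ) else 0) - 1 := by
  rw [← AddChar.sum_apply_mul_eq_ite hψ, ← Finset.add_sum_erase univ _ (mem_univ (0 : K)),
    ← Finset.add_sum_erase univ (fun x => ψ (x * b)) (mem_univ (0 : K)),
    Finset.sum_congr rfl fun x hx => if_neg (Finset.ne_of_mem_erase hx)]
  simp

/-- The quadratic Gauss sum `∑ ψ(x ^ 2)`. -/
noncomputable def quadraticGaussSum (ψ : AddChar K ℂ) : ℂ := ∑ x, ψ (x ^ 2)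

theorem norm_quadraticGaussSum (hK : ringChar K ≠ 2) {ψ : AddChar K ℂ} (hψ : ψ ≠ 1) :
    ‖quadraticGaussSum ψ‖ = √(Fintype.card K) := by
  have h2 : (2 : K) ≠ 0 := Ring.two_ne_zero hK
  have h : quadraticGaussSum ψ * (starRingEnd ℂ) (quadraticGaussSum ψ) = Fintype.card K := by
    rw [quadraticGaussSum, map_sum, Finset.sum_mul_sum, Finset.sum_comm]
    calc ∑ y, ∑ x, ψ (x ^ 2) * (starRingEnd ℂ) (ψ (y ^ 2))
        = ∑ y, ∑ x, ψ (x ^ 2) * ψ (y * (2 * x)) := by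
          refine Finset.sum_congr rfl fun y _ => ?_
          rw [← Equiv.sum_comp (Equiv.addRight y)]
          refine Finset.sum_congr rfl fun x _ => ?_
          rw [← AddChar.map_neg_eq_conj, ← AddChar.map_add_eq_mul, ← AddChar.map_add_eq_mul]
          congr 1
          simp only [Equiv.coe_addRight]
          ring
      _ = ∑ x : K, if x = 0 then (Fintype.card K : ℂ) else 0 := by
          rw [Finset.sum_comm]
          refine Finset.sum_congr rfl fun x _ => ?_
          rw [← Finset.mul_sum, AddChar.sum_apply_mul_eq_ite hψ]
          by_cases hx : x = 0
          · simp [hx]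
          · simp [hx, h2]
      _ = _ := by simp
  rw [Complex.mul_conj'] at h
  rw [← Real.sqrt_sq (norm_nonneg _)]
  congr 1
  exact_mod_cast h

theorem sum_apply_mul_sq (hK : ringChar K ≠ 2) {ψ : AddChar K ℂ} (hψ : ψ ≠ 1) {s : K}
    (hs : s ≠ 0) :
    ∑ x, ψ (s * x ^ 2) = (quadraticChar K s : ℂ) * quadraticGaussSum ψ := by
  have key : ∀ s : K, s ≠ 0 →
      ∑ x, ψ (s * x ^ 2) = ∑ t, (quadraticChar K t : ℂ) * ψ (s * t) := by
    intro s hs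
    rw [sum_comp_sq hK (fun t => ψ (s * t))]
    simp only [add_mul, one_mul, Finset.sum_add_distrib]
    rw [Finset.sum_congr rfl (fun t _ => by rw [mul_comm s t]),
      AddChar.sum_apply_mul_eq_ite hψ, if_neg hs, zero_add]
  have h1 := key 1 one_ne_zero
  simp only [one_mul] at h1
  rw [key s hs, quadraticGaussSum, h1, Finset.mul_sum]
  symm
  rw [← Equiv.sum_comp (Equiv.mulLeft₀ s hs)]
  refine Finset.sum_congr rfl fun t _ => ?_
  have hsq : (quadraticChar K s : ℂ) * (quadraticChar K s : ℂ) = 1 := by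
    rcases quadraticChar_dichotomy hs with h | h <;> rw [h] <;> norm_num
  rw [Equiv.mulLeft₀_apply, map_mul]
  push_cast
  linear_combination (quadraticChar K t * ψ (s * t)) * hsq

/-- The twisted Kloosterman sum `∑ η(s) ψ(c s + b / s)` over nonzero `s`. -/
noncomputable def salieSum (ψ : AddChar K ℂ) (c b : K) : ℂ :=
  ∑ s, if s = 0 then 0 else (quadraticChar K s : ℂ) * ψ (c * s + b * s⁻¹)

theorem salieSum_neg_one_mul (hK : ringChar K ≠ 2) {ψ : AddChar K ℂ} (hψ : ψ ≠ 1) (c : K) :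
    salieSum ψ c (-1) * quadraticGaussSum ψ =
      ∑ x, if x ^ 2 + c = 0 then Fintype.card K * ψ (2 * x) else 0 := by
  have h2 : (2 : K) ≠ 0 := Ring.two_ne_zero hK
  calc salieSum ψ c (-1) * quadraticGaussSum ψ
      = ∑ s, ∑ x, ψ (2 * x) * (if s = 0 then 0 else ψ (s * (x ^ 2 + c))) := by
        rw [salieSum, Finset.sum_mul]
        refine Finset.sum_congr rfl fun s _ => ?_
        by_cases hs : s = 0
        · simp [hs]
        simp only [if_neg hs]
        rw [mul_assoc, mul_left_comm, ← sum_apply_mul_sq hK hψ hs, Finset.mul_sum,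
          ← Equiv.sum_comp (Equiv.addRight s⁻¹)]
        refine Finset.sum_congr rfl fun x _ => ?_
        rw [← AddChar.map_add_eq_mul, ← AddChar.map_add_eq_mul]
        congr 1
        simp only [Equiv.coe_addRight]
        field_simp
        ring
    _ = ∑ x, ψ (2 * x) * ((if x ^ 2 + c = 0 then (Fintype.card K : ℂ) else 0) - 1) := by
        rw [Finset.sum_comm]
        refine Finset.sum_congr rfl fun x _ => ?_
        rw [← Finset.mul_sum, AddChar.sum_erase_zero_apply_mul_eq hψ]
    _ = _ := by
        simp only [mul_sub, mul_one, Finset.sum_sub_distrib]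
        rw [Finset.sum_congr rfl (fun (t : K) _ => by rw [mul_comm 2 t]) (s₁ := univ)
          (f := fun x => ψ (2 * x)), AddChar.sum_apply_mul_eq_ite hψ, if_neg h2, sub_zero]
        refine Finset.sum_congr rfl fun x _ => ?_
        split_ifs <;> ring

theorem salieSum_mul (ψ : AddChar K ℂ) (c b : K) {l : K} (hl : l ≠ 0) :
    salieSum ψ c b = quadraticChar K l * salieSum ψ (c * l) (b * l⁻¹) := by
  rw [salieSum, salieSum, ← Equiv.sum_comp (Equiv.mulLeft₀ l hl), Finset.mul_sum]
  refine Finset.sum_congr rfl fun s _ => ?_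
  simp only [Equiv.mulLeft₀_apply, mul_eq_zero, hl, false_or, map_mul]
  split_ifs with hs
  · simp
  push_cast
  rw [mul_assoc, mul_inv]
  congr 3
  ring_nf

theorem norm_quadraticChar {s : K} (hs : s ≠ 0) : ‖(quadraticChar K s : ℂ)‖ = 1 := by
  rcases quadraticChar_dichotomy hs with h | h <;> rw [h] <;> simp

theorem norm_salieSum_le (hK : ringChar K ≠ 2) {ψ : AddChar K ℂ} (hψ : ψ ≠ 1) {c : K}
    (hc : c ≠ 0) (b : K) :
    ‖salieSum ψ c b‖ ≤ 2 * √(Fintype.card K) := by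
  have hpos : (0 : ℝ) < √(Fintype.card K) :=
    Real.sqrt_pos.mpr (by exact_mod_cast Fintype.card_pos_iff.mpr ⟨(0 : K)⟩)
  by_cases hb : b = 0
  · subst hb
    have h : salieSum ψ c 0 = ∑ x, ψ (c * x ^ 2) := by
      rw [sum_comp_sq hK (fun t => ψ (c * t)), salieSum]
      simp only [add_mul, one_mul, Finset.sum_add_distrib, zero_mul, add_zero]
      rw [Finset.sum_congr rfl (fun (t : K) _ => by rw [mul_comm c t]) (s₁ := univ)
          (f := fun x => ψ (c * x)), AddChar.sum_apply_mul_eq_ite hψ, if_neg hc, zero_add]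
      refine Finset.sum_congr rfl fun s _ => ?_
      split_ifs with hs
      · simp [hs]
      · rfl
    rw [h, sum_apply_mul_sq hK hψ hc, norm_mul, norm_quadraticChar hc, one_mul,
      norm_quadraticGaussSum hK hψ]
    linarith
  · have hl : -b ≠ 0 := neg_ne_zero.mpr hb
    rw [salieSum_mul ψ c b hl, norm_mul, norm_quadraticChar hl, one_mul]
    have hb1 : b * (-b)⁻¹ = -1 := by field_simp
    rw [hb1]
    have h := congrArg norm (salieSum_neg_one_mul hK hψ (c * -b))
    rw [norm_mul, norm_quadraticGaussSum hK hψ] at h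
    have hcard : #{x : K | x ^ 2 + c * -b = 0} ≤ 2 := by
      have h1 := quadraticChar_card_sqrts hK (c * b)
      rw [Set.toFinset_ofPred] at h1
      have h3 : ({x : K | x ^ 2 + c * -b = 0} : Finset K) =
          ({x : K | x ^ 2 = c * b} : Finset K) := by
        refine Finset.filter_congr fun x _ => ?_
        exact ⟨fun h => by linear_combination h, fun h => by linear_combination h⟩
      rw [h3]
      have h4 : quadraticChar K (c * b) ≤ 1 := by
        rcases quadraticChar_dichotomy (mul_ne_zero hc hb) with h | h <;> norm_num [h]
      omega
    have hle : ‖∑ x, if x ^ 2 + c * -b = 0 then Fintype.card K * ψ (2 * x) else 0‖ ≤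
        2 * Fintype.card K := by
      rw [← Finset.sum_filter]
      refine (norm_sum_le_of_le _ (n := fun _ => (Fintype.card K : ℝ)) fun x _ => ?_).trans ?_
      · rw [norm_mul, AddChar.norm_apply, mul_one, Complex.norm_natCast]
      · rw [Finset.sum_const, nsmul_eq_mul]
        gcongr
        exact_mod_cast hcard
    have hq : (Fintype.card K : ℝ) = √(Fintype.card K) * √(Fintype.card K) :=
      (Real.mul_self_sqrt (by positivity)).symm
    rw [← h, hq, ← mul_assoc] at hle
    exact le_of_mul_le_mul_right (by simpa using hle) hpos

end SalieSum

section TwistedSum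

variable {K : Type} [Field K] [Fintype K]

theorem norm_sum_quadraticChar_pow_le (hK : Odd (Fintype.card K)) {ψ : AddChar K ℂ}
    (hψ : ψ ≠ 1) (d : ℕ) {c : K} (hc : c ≠ 0) (b : K) :
    ‖∑ s, if s = 0 then 0 else (quadraticChar K s : ℂ) ^ d * ψ (c * s + b * s⁻¹)‖ ≤
      2 * √(Fintype.card K) := by
  have hK' := ringChar_ne_two_of_odd_card hK
  have h1 : (1 : ℝ) ≤ √(Fintype.card K) := by
    rw [Real.one_le_sqrt]
    exact_mod_cast Fintype.card_pos_iff.mpr ⟨(0 : K)⟩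
  have hsq : ∀ s : K, s ≠ 0 → (quadraticChar K s : ℂ) ^ 2 = 1 := by
    intro s hs
    rcases quadraticChar_dichotomy hs with h | h <;> rw [h] <;> norm_num
  rcases Nat.even_or_odd' d with ⟨e, rfl | rfl⟩
  · have h : (∑ s, if s = 0 then 0 else (quadraticChar K s : ℂ) ^ (2 * e) * ψ (c * s + b * s⁻¹))
        = kloostermanSum ψ (c * b) := by
      symm
      rw [kloostermanSum, ← Equiv.sum_comp (Equiv.mulLeft₀ c hc)]
      refine Finset.sum_congr rfl fun s _ => ?_
      simp only [Equiv.mulLeft₀_apply, mul_eq_zero, hc, false_or]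
      split_ifs with hs
      · rfl
      rw [pow_mul, hsq s hs, one_pow, one_mul]
      congr 1
      field_simp
    rw [h]
    by_cases hb : b = 0
    · subst hb
      have h0 := AddChar.sum_erase_zero_apply_mul_eq hψ 1
      simp only [mul_one, one_ne_zero, if_false, zero_sub] at h0
      rw [kloostermanSum]
      simp only [mul_zero, zero_mul, add_zero]
      rw [h0]
      simp only [norm_neg, norm_one]
      linarith
    · exact norm_kloostermanSum_le hK hψ (mul_ne_zero hc hb)
  · have h : (∑ s, if s = 0 then 0 else
        (quadraticChar K s : ℂ) ^ (2 * e + 1) * ψ (c * s + b * s⁻¹)) = salieSum ψ c b := by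
      refine Finset.sum_congr rfl fun s _ => ?_
      split_ifs with hs
      · rfl
      rw [pow_succ, pow_mul, hsq s hs, one_pow, one_mul]
    rw [h]
    exact norm_salieSum_le hK' hψ hc b

end TwistedSum

section SpectralBound

open QuadraticMap

variable {K : Type} [Field K] [Fintype K] {d : ℕ} {Q : QuadraticForm K (Fin d → K)}

theorem AddChar.map_sum_eq_prod {ι A : Type*} [AddCommGroup A] (ψ : AddChar A ℂ) (S : Finset ι)
    (f : ι → A) : ψ (∑ i ∈ S, f i) = ∏ i ∈ S, ψ (f i) := by
  induction S using Finset.induction with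
  | empty => simp
  | insert i S hi ih =>
    rw [Finset.sum_insert hi, Finset.prod_insert hi, AddChar.map_add_eq_mul, ih]

theorem sum_apply_mul_weightedSumSquares (hK : ringChar K ≠ 2) {ψ : AddChar K ℂ} (hψ : ψ ≠ 1)
    {n : ℕ} (w : Fin n → Kˣ) {s : K} (hs : s ≠ 0) :
    ∑ x, ψ (s * weightedSumSquares K w x) = (quadraticChar K s : ℂ) ^ n *
      ∏ i, ((quadraticChar K (w i : K) : ℂ) * quadraticGaussSum ψ) := by
  have h : ∀ i, ∑ t, ψ (s * w i * t ^ 2) =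
      quadraticChar K s * ((quadraticChar K (w i : K) : ℂ) * quadraticGaussSum ψ) := by
    intro i
    rw [sum_apply_mul_sq hK hψ (mul_ne_zero hs (w i).ne_zero), map_mul]
    push_cast
    ring
  have hpow : (quadraticChar K s : ℂ) ^ n = ∏ _i : Fin n, (quadraticChar K s : ℂ) := by simp
  rw [hpow, ← Finset.prod_mul_distrib, ← Finset.prod_congr rfl fun i _ => h i, Fintype.prod_sum]
  refine Finset.sum_congr rfl fun x _ => ?_
  rw [weightedSumSquares_apply, Finset.mul_sum, AddChar.map_sum_eq_prod]
  refine Finset.prod_congr rfl fun i _ => ?_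
  congr 1
  rw [Units.smul_def, smul_eq_mul]
  ring

theorem QuadraticForm.exists_sum_apply_mul_eq (hK : ringChar K ≠ 2)
    (hQ : ∀ x, (∀ y, polar Q x y = 0) → x = 0) {ψ : AddChar K ℂ} (hψ : ψ ≠ 1) :
    ∃ γ : ℂ, ‖γ‖ = √(Fintype.card K) ^ d ∧
      ∀ s : K, s ≠ 0 → ∑ x, ψ (s * Q x) = (quadraticChar K s : ℂ) ^ d * γ := by
  have h2 : (2 : K) ≠ 0 := Ring.two_ne_zero hK
  let _ : Invertible (2 : K) := invertibleOfNonzero h2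
  have hsep : LinearMap.SeparatingLeft (associated Q) := by
    intro x hx
    refine hQ x fun y => ?_
    have h := LinearMap.congr_fun₂ (two_nsmul_associated K Q) x y
    rw [polarBilin_apply_apply] at h
    rw [← h, LinearMap.smul_apply, LinearMap.smul_apply, hx y, smul_zero]
  have hweights := QuadraticForm.equivalent_weightedSumSquares_units_of_nondegenerate' Q hsep
  rw [Module.finrank_fin_fun] at hweights
  obtain ⟨w, ⟨e⟩⟩ := hweights
  refine ⟨∏ i, ((quadraticChar K (w i : K) : ℂ) * quadraticGaussSum ψ), ?_, fun s hs => ?_⟩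
  · rw [norm_prod, Finset.prod_congr rfl fun i _ => by
      rw [norm_mul, norm_quadraticChar (w i).ne_zero, one_mul, norm_quadraticGaussSum hK hψ],
      Finset.prod_const, Finset.card_univ, Fintype.card_fin]
  · rw [← sum_apply_mul_weightedSumSquares hK hψ w hs]
    refine Fintype.sum_equiv e.toLinearEquiv.toEquiv _ _ fun x => ?_
    rw [← e.map_app x]
    rfl

theorem sum_apply_mul_sub_eq {ψ : AddChar K ℂ} (hψ : ψ ≠ 1) (c t : K) :
    ∑ s : K, (if s = 0 then 0 else ψ (s * (t - c))) =
      Fintype.card K * (if t = c then 1 else 0) - 1 := by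
  rw [AddChar.sum_erase_zero_apply_mul_eq hψ]
  simp only [sub_eq_zero]
  split_ifs <;> ring

theorem norm_sum_indicator_sub_mul_le (hK : Odd (Fintype.card K))
    (hQ : ∀ x, (∀ y, polar Q x y = 0) → x = 0) {ψ : AddChar K ℂ} (hψ : ψ ≠ 1) {c : K} (hc : c ≠ 0)
    (m : Fin d → K) :
    ‖∑ x, (Fintype.card K * (if Q x = c then 1 else 0) - 1) * ψ (polar Q m x)‖ ≤
      2 * √(Fintype.card K) ^ (d + 1) := by
  have hK' := ringChar_ne_two_of_odd_card hK
  obtain ⟨γ, hγ, hsum⟩ := QuadraticForm.exists_sum_apply_mul_eq hK' hQ hψ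
  have h : ∑ x, (Fintype.card K * (if Q x = c then 1 else 0) - 1) * ψ (polar Q m x) =
      γ * ∑ s, if s = 0 then 0 else (quadraticChar K s : ℂ) ^ d * ψ (-c * s + -Q m * s⁻¹) := by
    calc _ = ∑ s, ∑ x, (if s = 0 then 0 else ψ (s * (Q x - c))) * ψ (polar Q m x) := by
          rw [Finset.sum_comm]
          refine Finset.sum_congr rfl fun x _ => ?_
          rw [← sum_apply_mul_sub_eq hψ, Finset.sum_mul]
      _ = _ := by
          rw [Finset.mul_sum]
          refine Finset.sum_congr rfl fun s _ => ?_
          by_cases hs : s = 0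
          · simp [hs]
          simp only [if_neg hs]
          rw [← mul_assoc, mul_comm γ, ← hsum s hs, Finset.sum_mul]
          symm
          rw [← Equiv.sum_comp (Equiv.addRight (s⁻¹ • m))]
          refine Finset.sum_congr rfl fun x _ => ?_
          rw [← AddChar.map_add_eq_mul, ← AddChar.map_add_eq_mul]
          congr 1
          simp only [Equiv.coe_addRight]
          rw [QuadraticMap.map_add Q, QuadraticMap.map_smul, polar_smul_right, polar_comm Q x m,
            smul_eq_mul, smul_eq_mul]
          field_simp
          ring
  rw [h, norm_mul, hγ, pow_succ, mul_left_comm]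
  exact mul_le_mul_of_nonneg_left
    (norm_sum_quadraticChar_pow_le hK hψ d (neg_ne_zero.mpr hc) _) (by positivity)

theorem sum_apply_polar (hQ : ∀ x, (∀ y, polar Q x y = 0) → x = 0) {ψ : AddChar K ℂ} (hψ : ψ ≠ 1)
    (x : Fin d → K) :
    ∑ m, ψ (polar Q m x) = if x = 0 then (Fintype.card (Fin d → K) : ℂ) else 0 := by
  split_ifs with hx
  · subst hx
    simp
  · obtain ⟨m, hm⟩ : ∃ m, polar Q m x ≠ 0 := by
      by_contra! h
      exact hx (hQ x fun y => by rw [polar_comm, h])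
    have hne : ψ.compAddMonoidHom (Q.polarBilin.flip x).toAddMonoidHom ≠ 1 := by
      intro h
      apply hψ
      ext t
      have := DFunLike.congr_fun h ((t * (polar Q m x)⁻¹) • m)
      simpa [hm] using this
    exact AddChar.sum_eq_zero_of_ne_one hne

theorem sum_norm_sq_sum_apply_polar (hQ : ∀ x, (∀ y, polar Q x y = 0) → x = 0)
    {ψ : AddChar K ℂ} (hψ : ψ ≠ 1) (S : Finset (Fin d → K)) :
    ∑ m, ‖∑ x ∈ S, ψ (polar Q m x)‖ ^ 2 = Fintype.card (Fin d → K) * #S := by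
  rw [← Complex.ofReal_inj]
  push_cast
  calc ∑ m, (‖∑ x ∈ S, ψ (polar Q m x)‖ : ℂ) ^ 2
      = ∑ m, ∑ x ∈ S, ∑ y ∈ S, ψ (polar Q m (x - y)) := by
        refine Finset.sum_congr rfl fun m _ => ?_
        rw [← Complex.mul_conj', map_sum, Finset.sum_mul_sum]
        refine Finset.sum_congr rfl fun x _ => Finset.sum_congr rfl fun y _ => ?_
        rw [← AddChar.map_neg_eq_conj, ← AddChar.map_add_eq_mul, polar_sub_right, sub_eq_add_neg]
    _ = ∑ x ∈ S, ∑ y ∈ S, if x = y then (Fintype.card (Fin d → K) : ℂ) else 0 := by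
        rw [Finset.sum_comm]
        refine Finset.sum_congr rfl fun x _ => ?_
        rw [Finset.sum_comm]
        refine Finset.sum_congr rfl fun y _ => ?_
        rw [sum_apply_polar hQ hψ]
        simp only [sub_eq_zero]
    _ = _ := by
        rw [Finset.sum_congr rfl fun x hx => by rw [Finset.sum_ite_eq, if_pos hx],
          Finset.sum_const, nsmul_eq_mul, mul_comm]

theorem norm_sum_sum_apply_sub_le (hQ : ∀ x, (∀ y, polar Q x y = 0) → x = 0)
    {ψ : AddChar K ℂ} (hψ : ψ ≠ 1) {h : (Fin d → K) → ℂ} {M : ℝ}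
    (hM : ∀ m, ‖∑ x, h x * ψ (polar Q m x)‖ ≤ M) (S T : Finset (Fin d → K)) :
    ‖∑ x ∈ S, ∑ y ∈ T, h (x - y)‖ ≤ M * (√(#S) * √(#T)) := by
  have hM0 : 0 ≤ M := (norm_nonneg _).trans (hM 0)
  set N : ℝ := (Fintype.card (Fin d → K) : ℝ) with hN
  have hNpos : 0 < N := by
    rw [hN]
    exact_mod_cast Fintype.card_pos_iff.mpr ⟨(0 : Fin d → K)⟩
  have hinv : (N : ℂ) * ∑ x ∈ S, ∑ y ∈ T, h (x - y) =
      ∑ m, (∑ z, h z * ψ (polar Q m z)) *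
        ((starRingEnd ℂ) (∑ x ∈ S, ψ (polar Q m x)) * ∑ y ∈ T, ψ (polar Q m y)) := by
    symm
    calc _ = ∑ m, ∑ x ∈ S, ∑ y ∈ T, ∑ z, h z * ψ (polar Q m (z - (x - y))) := by
          refine Finset.sum_congr rfl fun m _ => ?_
          rw [map_sum, Finset.sum_mul_sum, Finset.mul_sum]
          refine Finset.sum_congr rfl fun x _ => ?_
          rw [Finset.mul_sum]
          refine Finset.sum_congr rfl fun y _ => ?_
          rw [Finset.sum_mul]
          refine Finset.sum_congr rfl fun z _ => ?_
          rw [← AddChar.map_neg_eq_conj, ← AddChar.map_add_eq_mul, mul_assoc,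
            ← AddChar.map_add_eq_mul, polar_sub_right, polar_sub_right]
          congr 2
          ring
      _ = ∑ x ∈ S, ∑ y ∈ T, ∑ z, if z = x - y then h z * N else 0 := by
          rw [Finset.sum_comm]
          refine Finset.sum_congr rfl fun x _ => ?_
          rw [Finset.sum_comm]
          refine Finset.sum_congr rfl fun y _ => ?_
          rw [Finset.sum_comm]
          refine Finset.sum_congr rfl fun z _ => ?_
          rw [← Finset.mul_sum, sum_apply_polar hQ hψ]
          simp only [sub_eq_zero, mul_ite, mul_zero, hN, Complex.ofReal_natCast]
      _ = _ := by
          rw [Finset.mul_sum]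
          refine Finset.sum_congr rfl fun x _ => ?_
          rw [Finset.mul_sum]
          refine Finset.sum_congr rfl fun y _ => ?_
          rw [Finset.sum_ite_eq' univ, if_pos (mem_univ _), mul_comm]
  have hbound : ‖(N : ℂ) * ∑ x ∈ S, ∑ y ∈ T, h (x - y)‖ ≤ M * (√(N * #S) * √(N * #T)) := by
    rw [hinv]
    calc _ ≤ ∑ m, M * (‖∑ x ∈ S, ψ (polar Q m x)‖ * ‖∑ y ∈ T, ψ (polar Q m y)‖) := by
          refine norm_sum_le_of_le _ fun m _ => ?_
          rw [norm_mul, norm_mul, RCLike.norm_conj]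
          exact mul_le_mul_of_nonneg_right (hM m) (by positivity)
      _ ≤ _ := by
          rw [← Finset.mul_sum, ← sum_norm_sq_sum_apply_polar hQ hψ S,
            ← sum_norm_sq_sum_apply_polar hQ hψ T]
          exact mul_le_mul_of_nonneg_left (Real.sum_mul_le_sqrt_mul_sqrt _ _ _) hM0
  rw [norm_mul, Complex.norm_real, Real.norm_of_nonneg hNpos.le, Real.sqrt_mul hNpos.le,
    Real.sqrt_mul hNpos.le] at hbound
  have hs := Real.mul_self_sqrt hNpos.le
  refine le_of_mul_le_mul_left (hbound.trans (le_of_eq ?_)) hNpos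
  linear_combination (M * √(#S) * √(#T)) * hs

/-- Expander mixing for the graphs `Q (x - y) = c`. -/
theorem abs_card_filter_sub_le (hK : Odd (Fintype.card K))
    (hQ : ∀ x, (∀ y, polar Q x y = 0) → x = 0) {c : K} (hc : c ≠ 0) (S T : Finset (Fin d → K)) :
    |(∑ x ∈ S, ∑ y ∈ T, if Q (x - y) = c then 1 else 0 : ℝ) - #S * #T / Fintype.card K| ≤
      2 * √(Fintype.card K) ^ (d + 1) / Fintype.card K * (√(#S) * √(#T)) := by
  have hqpos : (0 : ℝ) < Fintype.card K := by
    exact_mod_cast Fintype.card_pos_iff.mpr ⟨(0 : K)⟩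
  obtain ⟨ψ, hψ1⟩ := AddChar.exists_apply_ne_zero.mpr (one_ne_zero (α := K))
  have hψ : ψ ≠ 1 := by
    rintro rfl
    exact hψ1 rfl
  have h := norm_sum_sum_apply_sub_le hQ hψ (norm_sum_indicator_sub_mul_le hK hQ hψ hc) S T
  have hreal : ∑ x ∈ S, ∑ y ∈ T, (Fintype.card K * (if Q (x - y) = c then 1 else 0) - 1 : ℂ) =
      (Fintype.card K * ((∑ x ∈ S, ∑ y ∈ T, if Q (x - y) = c then 1 else 0 : ℝ) -
        #S * #T / Fintype.card K) : ℝ) := by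
    simp only [Finset.sum_sub_distrib, ← Finset.mul_sum]
    rw [mul_sub, mul_div_cancel₀ _ hqpos.ne']
    push_cast
    simp only [apply_ite Complex.ofReal, Complex.ofReal_one, Complex.ofReal_zero,
      Finset.sum_const, nsmul_eq_mul, mul_one]
  rw [hreal, Complex.norm_real, Real.norm_eq_abs, abs_mul, abs_of_pos hqpos] at h
  rw [div_mul_eq_mul_div, le_div_iff₀ hqpos, mul_comm]
  exact h

end SpectralBound

section Counting

variable {ι V : Type*} {P : ι × ι → V → V → Prop} {E : Finset V}

/-- `A` is an orientation of a simple graph. -/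
def IsOriented (A : Finset (ι × ι)) : Prop :=
  ∀ e ∈ A, e.1 ≠ e.2 ∧ e.swap ∉ A

theorem IsOriented.mono {A B : Finset (ι × ι)} (hB : IsOriented B) (h : A ⊆ B) : IsOriented A :=
  fun e he => ⟨(hB e (h he)).1, fun h' => (hB e (h he)).2 (h h')⟩

/-- Every constraint behaves like a random constraint of density `1 / q`, with error `M`. -/
def IsMixing (P : ι × ι → V → V → Prop) (A : Finset (ι × ι)) (q M : ℝ) : Prop :=
  ∀ e ∈ A, ∀ S T : Finset V,
    |(∑ x ∈ S, ∑ y ∈ T, if P e x y then 1 else 0 : ℝ) - #S * #T / q| ≤ M * (√(#S) * √(#T))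

/-- The constraints not involving the vertex `i`. -/
noncomputable def deleteVertex (A : Finset (ι × ι)) (i : ι) : Finset (ι × ι) :=
  {e ∈ A | e.1 ≠ i ∧ e.2 ≠ i}

/-- For disjoint sets of constraints at `i` and at `j`, the constraints decouple. -/
theorem forall_update_update_iff {A : Finset (ι × ι)} {i j : ι} (hij : i ≠ j)
    (hA : ∀ e ∈ A, (e.1 = i ∨ e.2 = i) → e.1 ≠ j ∧ e.2 ≠ j) (z : ι → V) (a b : V) :
    (∀ e ∈ A, P e (Function.update (Function.update z i a) j b e.1)
        (Function.update (Function.update z i a) j b e.2)) ↔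
      (∀ e ∈ A, e.1 ≠ i ∧ e.2 ≠ i → e.1 ≠ j ∧ e.2 ≠ j → P e (z e.1) (z e.2)) ∧
      (∀ e ∈ A, e.1 = i ∨ e.2 = i → P e (Function.update z i a e.1) (Function.update z i a e.2)) ∧
      ∀ e ∈ A, e.1 = j ∨ e.2 = j →
        P e (Function.update z j b e.1) (Function.update z j b e.2) := by
  constructor
  · intro h
    refine ⟨fun e he h1 h2 => ?_, fun e he h1 => ?_, fun e he h1 => ?_⟩
    · simpa [Function.update_of_ne, h1, h2] using h e he
    · have h2 := hA e he h1
      simpa [Function.update_of_ne, h2] using h e he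
    · have h2 : e.1 ≠ i ∧ e.2 ≠ i := by
        by_contra hcon
        have := hA e he (by tauto)
        tauto
      rw [Function.update_comm hij]  at h
      simpa [Function.update_of_ne, h2] using h e he
  · rintro ⟨hR, hS, hT⟩ e he
    by_cases h1 : e.1 = i ∨ e.2 = i
    · have h2 := hA e he h1
      simpa [Function.update_of_ne, h2] using hS e he h1
    · push Not at h1
      by_cases h2 : e.1 = j ∨ e.2 = j
      · rw [Function.update_comm hij]
        simpa [Function.update_of_ne, h1] using hT e he h2
      · push Not at h2
        simpa [Function.update_of_ne, h1, h2] using hR e he h1 h2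

theorem ite_and_sub_ite_div (r p : Prop) [Decidable r] [Decidable p] [Decidable (r ∧ p)] (q : ℝ) :
    ((if r ∧ p then 1 else 0) - (if p then 1 else 0) / q : ℝ) =
      if p then (if r then 1 else 0) - 1 / q else 0 := by
  by_cases h : p <;> simp [h]

theorem sum_sum_ite_eq (E : Finset V) (s t : V → Prop) [DecidablePred s] [DecidablePred t]
    {u : V → V → Prop} [∀ a b, Decidable (u a b)] (hu : ∀ a b, u a b ↔ s a ∧ t b)
    (g : V → V → ℝ) (q : ℝ) :
    ∑ a ∈ E, ∑ b ∈ E, (if u a b then g a b - 1 / q else 0) =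
      (∑ a ∈ E with s a, ∑ b ∈ E with t b, g a b) - #{a ∈ E | s a} * #{b ∈ E | t b} / q := by
  have h : (#{a ∈ E | s a} * #{b ∈ E | t b} / q : ℝ) =
      ∑ a ∈ E with s a, ∑ b ∈ E with t b, 1 / q := by
    simp [mul_assoc, div_eq_mul_inv]
  rw [h, ← Finset.sum_sub_distrib, Finset.sum_filter]
  refine Finset.sum_congr rfl fun a _ => ?_
  rw [← Finset.sum_sub_distrib, Finset.sum_filter]
  by_cases hs : s a <;> simp [hs, hu]

variable [Fintype ι]

/-- Number of tuples in `E` satisfying the binary constraints `P e` for `e ∈ A`. -/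
noncomputable def homCount (P : ι × ι → V → V → Prop) (E : Finset V) (A : Finset (ι × ι)) : ℕ :=
  #{x ∈ Fintype.piFinset fun _ : ι => E | ∀ e ∈ A, P e (x e.1) (x e.2)}

theorem update_mem_piFinset {x : ι → V} (hx : x ∈ Fintype.piFinset fun _ : ι => E) (i : ι)
    {a : V} (ha : a ∈ E) : Function.update x i a ∈ Fintype.piFinset fun _ : ι => E := by
  rw [Fintype.mem_piFinset] at hx ⊢
  intro j
  by_cases h : j = i
  · subst h; simpa using ha
  · simpa [h] using hx j

theorem sum_sum_update (E : Finset V) (i : ι) (F : (ι → V) → ℝ) :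
    ∑ z ∈ Fintype.piFinset fun _ : ι => E, ∑ a ∈ E, F (Function.update z i a) =
      #E * ∑ x ∈ Fintype.piFinset fun _ : ι => E, F x := by
  rw [← nsmul_eq_mul, ← Finset.sum_const, Finset.sum_comm' (t' := Fintype.piFinset fun _ : ι => E)
    (s' := fun _ => E) (by tauto), ← Finset.sum_product', ← Finset.sum_product']
  refine Finset.sum_nbij' (fun z => (Function.update z.1 i z.2, z.1 i))
    (fun z => (Function.update z.1 i z.2, z.1 i)) ?_ ?_ ?_ ?_ ?_
  · rintro ⟨z, a⟩ h
    rw [Finset.mem_product] at h ⊢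
    exact ⟨update_mem_piFinset h.1 i h.2, Fintype.mem_piFinset.mp h.1 i⟩
  · rintro ⟨z, a⟩ h
    rw [Finset.mem_product] at h ⊢
    exact ⟨update_mem_piFinset h.1 i h.2, Fintype.mem_piFinset.mp h.1 i⟩
  · rintro ⟨z, a⟩ _
    simp
  · rintro ⟨z, a⟩ _
    simp
  · rintro ⟨z, a⟩ _
    rfl

theorem card_mul_homCount_eq_sum (A : Finset (ι × ι)) (i : ι) :
    (#E * homCount P E A : ℝ) = ∑ z ∈ Fintype.piFinset fun _ : ι => E, ∑ a ∈ E,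
      if ∀ e ∈ A, P e (Function.update z i a e.1) (Function.update z i a e.2) then 1 else 0 := by
  rw [sum_sum_update E i (fun x => if ∀ e ∈ A, P e (x e.1) (x e.2) then (1 : ℝ) else 0),
    Finset.sum_boole]
  rfl

theorem sum_card_filter_eq {A A' : Finset (ι × ι)} {i j : ι}
    (hAA' : ∀ e, (e.1 ≠ j ∧ e.2 ≠ j) → (e ∈ A ↔ e ∈ A'))
    (hA : ∀ e ∈ A', (e.1 = i ∨ e.2 = i) → e.1 ≠ j ∧ e.2 ≠ j) :
    ∑ z ∈ Fintype.piFinset fun _ : ι => E with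
        (∀ e ∈ A', e.1 ≠ i ∧ e.2 ≠ i → e.1 ≠ j ∧ e.2 ≠ j → P e (z e.1) (z e.2)),
      (#{a ∈ E | ∀ e ∈ A', e.1 = i ∨ e.2 = i →
        P e (Function.update z i a e.1) (Function.update z i a e.2)} : ℝ) =
      #E * homCount P E (deleteVertex A j) := by
  rw [card_mul_homCount_eq_sum _ i, Finset.sum_filter]
  refine Finset.sum_congr rfl fun z _ => ?_
  rw [Finset.sum_boole]
  have key : ∀ a, (∀ e ∈ deleteVertex A j,
      P e (Function.update z i a e.1) (Function.update z i a e.2)) ↔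
      (∀ e ∈ A', e.1 ≠ i ∧ e.2 ≠ i → e.1 ≠ j ∧ e.2 ≠ j → P e (z e.1) (z e.2)) ∧
      ∀ e ∈ A', e.1 = i ∨ e.2 = i →
        P e (Function.update z i a e.1) (Function.update z i a e.2) := by
    intro a
    constructor
    · intro h
      refine ⟨fun e he h1 h2 => ?_, fun e he h1 => ?_⟩
      · simpa [Function.update_of_ne, h1] using
          h e (Finset.mem_filter.mpr ⟨(hAA' e h2).mpr he, h2⟩)
      · have h2 := hA e he h1
        exact h e (Finset.mem_filter.mpr ⟨(hAA' e h2).mpr he, h2⟩)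
    · rintro ⟨hR, hS⟩ e he
      obtain ⟨he, h2⟩ := Finset.mem_filter.mp he
      have he' := (hAA' e h2).mp he
      by_cases h1 : e.1 = i ∨ e.2 = i
      · exact hS e he' h1
      · push Not at h1
        simpa [Function.update_of_ne, h1] using hR e he' h1 h2
  simp only [key]
  split_ifs with hR
  · exact congrArg _ (congrArg _ (Finset.filter_congr fun a _ => (and_iff_right hR).symm))
  · rw [Finset.filter_false_of_mem fun a _ h => hR h.1, Finset.card_empty, Nat.cast_zero]

theorem abs_homCount_sub_le {A : Finset (ι × ι)} (hA : IsOriented A)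
    {q M : ℝ} (hM : 0 ≤ M) (hmix : IsMixing P A q M) (hE : E.Nonempty) {e₀ : ι × ι} (he₀ : e₀ ∈ A) :
    |(homCount P E A : ℝ) - homCount P E (A.erase e₀) / q| ≤
      M / #E * (√(homCount P E (deleteVertex A e₀.1)) * √(homCount P E (deleteVertex A e₀.2))) := by
  obtain ⟨i, j⟩ := e₀
  have hij : i ≠ j := (hA _ he₀).1
  set A' := A.erase (i, j) with hA'
  have hAA' : ∀ e : ι × ι, (e.1 ≠ i ∨ e.2 ≠ j) → (e ∈ A ↔ e ∈ A') := by
    rintro e he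
    rw [hA', Finset.mem_erase]
    refine ⟨fun h => ⟨?_, h⟩, fun h => h.2⟩
    rintro rfl
    simp at he
  have hsep : ∀ e ∈ A', (e.1 = i ∨ e.2 = i) → e.1 ≠ j ∧ e.2 ≠ j := by
    rintro ⟨u, v⟩ he h
    obtain ⟨hne, hmem⟩ := Finset.mem_erase.mp he
    have hswap := (hA _ hmem).2
    simp only [ne_eq, Prod.mk.injEq] at hne h ⊢
    rcases h with rfl | rfl
    · exact ⟨hij, fun h => hne ⟨rfl, h⟩⟩
    · exact ⟨fun h => by subst h; exact hswap he₀, hij⟩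
  have hsep' : ∀ e ∈ A', (e.1 = j ∨ e.2 = j) → e.1 ≠ i ∧ e.2 ≠ i := by
    intro e he h
    have := hsep e he
    tauto
  set R : (ι → V) → Prop := fun z =>
    ∀ e ∈ A', e.1 ≠ i ∧ e.2 ≠ i → e.1 ≠ j ∧ e.2 ≠ j → P e (z e.1) (z e.2) with hR
  set S : (ι → V) → Finset V := fun z => {a ∈ E | ∀ e ∈ A', e.1 = i ∨ e.2 = i →
    P e (Function.update z i a e.1) (Function.update z i a e.2)} with hS
  set T : (ι → V) → Finset V := fun z => {b ∈ E | ∀ e ∈ A', e.1 = j ∨ e.2 = j →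
    P e (Function.update z j b e.1) (Function.update z j b e.2)} with hT
  set D : ℝ := (homCount P E A : ℝ) - homCount P E A' / q with hD
  have hEpos : (0 : ℝ) < #E := by exact_mod_cast hE.card_pos
  have hmain : #E * (#E * D) = ∑ z ∈ Fintype.piFinset (fun _ : ι => E) with R z,
      ((∑ a ∈ S z, ∑ b ∈ T z, if P (i, j) a b then 1 else 0 : ℝ) - #(S z) * #(T z) / q) := by
    have hDsum : D = ∑ x ∈ Fintype.piFinset fun _ : ι => E,
        if ∀ e ∈ A', P e (x e.1) (x e.2) then
          ((if P (i, j) (x i) (x j) then 1 else 0 : ℝ) - 1 / q) else 0 := by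
      have hcount : ∀ B : Finset (ι × ι), (homCount P E B : ℝ) =
          ∑ x ∈ Fintype.piFinset fun _ : ι => E, if ∀ e ∈ B, P e (x e.1) (x e.2) then 1 else 0 := by
        intro B
        rw [Finset.sum_boole]
        rfl
      rw [hD, hcount, hcount, Finset.sum_div, ← Finset.sum_sub_distrib]
      refine Finset.sum_congr rfl fun x _ => ?_
      have hins : (∀ e ∈ A, P e (x e.1) (x e.2)) ↔
          P (i, j) (x i) (x j) ∧ ∀ e ∈ A', P e (x e.1) (x e.2) := by
        rw [← Finset.insert_erase he₀, Finset.forall_mem_insert]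
      rw [if_congr hins rfl rfl, ite_and_sub_ite_div]
    rw [hDsum, ← sum_sum_update E j, ← sum_sum_update E i, Finset.sum_filter]
    refine Finset.sum_congr rfl fun z _ => ?_
    have hiff := forall_update_update_iff (P := P) hij hsep z
    split_ifs with hRz
    · simp_rw [Function.update_of_ne hij, Function.update_self]
      exact sum_sum_ite_eq E _ _ (fun a b => (hiff a b).trans (and_iff_right hRz))
        (fun a b => if P (i, j) a b then 1 else 0) q
    · exact Finset.sum_eq_zero fun a _ => Finset.sum_eq_zero fun b _ =>
        if_neg fun h => hRz ((hiff a b).mp h).1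
  have hcardS : ∑ z ∈ Fintype.piFinset (fun _ : ι => E) with R z, (#(S z) : ℝ) =
      #E * homCount P E (deleteVertex A j) :=
    sum_card_filter_eq (fun e h => hAA' e (Or.inr h.2)) hsep
  have hcardT : ∑ z ∈ Fintype.piFinset (fun _ : ι => E) with R z, (#(T z) : ℝ) =
      #E * homCount P E (deleteVertex A i) := by
    rw [← sum_card_filter_eq (fun e h => hAA' e (Or.inl h.1)) hsep']
    refine Finset.sum_congr (Finset.filter_congr fun z _ => ?_) fun z _ => rfl
    exact forall₂_congr fun e _ => ⟨fun h a b => h b a, fun h a b => h b a⟩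
  have hbound : |#E * (#E * D)| ≤ M * (#E * (√(homCount P E (deleteVertex A i)) *
      √(homCount P E (deleteVertex A j)))) := by
    calc |#E * (#E * D)| ≤ ∑ z ∈ Fintype.piFinset (fun _ : ι => E) with R z,
          M * (√(#(S z)) * √(#(T z))) := by
          rw [hmain]
          exact (Finset.abs_sum_le_sum_abs _ _).trans
            (Finset.sum_le_sum fun z _ => hmix _ he₀ _ _)
      _ ≤ M * (√(∑ z ∈ Fintype.piFinset (fun _ : ι => E) with R z, (#(S z) : ℝ)) *
          √(∑ z ∈ Fintype.piFinset (fun _ : ι => E) with R z, (#(T z) : ℝ))) := by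
          rw [← Finset.mul_sum]
          exact mul_le_mul_of_nonneg_left (Real.sum_sqrt_mul_sqrt_le _ (fun _ => Nat.cast_nonneg _)
            fun _ => Nat.cast_nonneg _) hM
      _ = _ := by
          rw [hcardS, hcardT, Real.sqrt_mul hEpos.le, Real.sqrt_mul hEpos.le]
          nth_rewrite 3 [← Real.mul_self_sqrt hEpos.le]
          ring
  rw [abs_mul, abs_mul, abs_of_pos hEpos] at hbound
  have h2 : #E * |D| ≤ M * (√(homCount P E (deleteVertex A i)) *
      √(homCount P E (deleteVertex A j))) := by
    refine le_of_mul_le_mul_left (hbound.trans_eq ?_) hEpos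
    ring
  rw [div_mul_eq_mul_div, le_div_iff₀ hEpos, mul_comm |D|]
  exact h2

end Counting

section Induction

variable {ι V : Type*} {P : ι × ι → V → V → Prop} {E : Finset V} {A : Finset (ι × ι)}

theorem deleteVertex_ssubset {e : ι × ι} (he : e ∈ A) {i : ι} (hi : e.1 = i ∨ e.2 = i) :
    deleteVertex A i ⊂ A :=
  Finset.filter_ssubset.mpr ⟨e, he, by tauto⟩

variable [Fintype ι]

theorem card_le_card_deleteVertex_add (hA : IsOriented A) (i : ι) :
    #A ≤ #(deleteVertex A i) + (Fintype.card ι - 1) := by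
  rw [← Finset.card_filter_add_card_filter_not (s := A) (fun e => e.1 ≠ i ∧ e.2 ≠ i)]
  refine Nat.add_le_add le_rfl ?_
  rw [← Finset.card_univ, ← Finset.card_erase_of_mem (Finset.mem_univ i)]
  refine Finset.card_le_card_of_injOn (fun e => if e.1 = i then e.2 else e.1) ?_ ?_
  · rintro ⟨u, v⟩ he
    obtain ⟨he, h⟩ := Finset.mem_filter.mp he
    have huv : u ≠ v := (hA _ he).1
    simp only [Finset.coe_erase, Finset.coe_univ, Set.mem_sdiff, Set.mem_univ,
      Set.mem_singleton_iff, true_and]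
    split_ifs with hu
    · exact fun hv => huv (hu.trans hv.symm)
    · exact hu
  · rintro ⟨u, v⟩ he ⟨u', v'⟩ he' heq
    obtain ⟨he1, h⟩ := Finset.mem_filter.mp he
    obtain ⟨he1', h'⟩ := Finset.mem_filter.mp he'
    have h1 := (hA _ he1).2
    simp only [Prod.swap_prod_mk, ne_eq] at h1 heq h h' ⊢
    have hv : u = i ∨ v = i := by tauto
    have hv' : u' = i ∨ v' = i := by tauto
    by_cases hu : u = i <;> by_cases hu' : u' = i
    · subst hu; simp_all
    · have := hv'.resolve_left hu'
      rw [if_pos hu, if_neg hu'] at heq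
      subst hu; subst heq; subst this
      exact absurd he1' h1
    · have := hv.resolve_left hu
      rw [if_neg hu, if_pos hu'] at heq
      subst hu'; subst heq; subst this
      exact absurd he1' h1
    · have := hv.resolve_left hu
      have := hv'.resolve_left hu'
      rw [if_neg hu, if_neg hu'] at heq
      simp_all

theorem homCount_empty : homCount P E ∅ = #E ^ Fintype.card ι := by
  simp [homCount]

theorem le_two_pow_mul_of_abs_sub_le {N Y ρ : ℝ} {n : ℕ} (hY : 0 ≤ Y) (hρ : ρ ≤ 1)
    (h : |N - Y| ≤ (2 ^ n - 1) * ρ * Y) : N ≤ 2 ^ n * Y := by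
  have h1 := (abs_le.mp h).2
  have h2 : (1 : ℝ) ≤ 2 ^ n := one_le_pow₀ one_le_two
  have h3 : (2 ^ n - 1) * ρ * Y ≤ (2 ^ n - 1) * 1 * Y := by gcongr
  linarith

theorem div_pow_card_deleteVertex_le (hA : IsOriented A) {q X : ℝ} (hq : 1 ≤ q) (hX : 0 ≤ X)
    (i : ι) : X / q ^ #(deleteVertex A i) ≤ X * q ^ (Fintype.card ι - 1) / q ^ #A := by
  rw [div_le_div_iff₀ (by positivity) (by positivity), mul_assoc, ← pow_add]
  gcongr
  rw [add_comm]
  exact card_le_card_deleteVertex_add hA i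

/-- Asymptotic count of tuples in a large set satisfying a system of mixing constraints. -/
theorem abs_homCount_sub_le_of_isMixing {q M : ℝ} (hq : 1 ≤ q) (hM : 0 ≤ M) (hE : E.Nonempty)
    (hρ : M * q ^ (Fintype.card ι - 1) / #E ≤ 1) (hA : IsOriented A) (hmix : IsMixing P A q M) :
    |(homCount P E A : ℝ) - #E ^ Fintype.card ι / q ^ #A| ≤
      (2 ^ #A - 1) * (M * q ^ (Fintype.card ι - 1) / #E) *
        (#E ^ Fintype.card ι / q ^ #A) := by
  induction A using Finset.strongInduction with
  | H A ih =>
  obtain rfl | ⟨e, he⟩ := A.eq_empty_or_nonempty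
  · simp [homCount_empty]
  have hEpos : (0 : ℝ) < #E := by exact_mod_cast hE.card_pos
  set X : ℝ := #E ^ Fintype.card ι with hX
  set ρ : ℝ := M * q ^ (Fintype.card ι - 1) / #E with hρdef
  have hX0 : 0 ≤ X := by positivity
  have hρ0 : 0 ≤ ρ := by positivity
  have hcard : #A = #(A.erase e) + 1 := (Finset.card_erase_add_one he).symm
  set n := #(A.erase e) with hn
  have hdel : ∀ i, e.1 = i ∨ e.2 = i →
      (homCount P E (deleteVertex A i) : ℝ) ≤ 2 ^ n * (X * q ^ (Fintype.card ι - 1) / q ^ #A) := by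
    intro i hi
    have hss := deleteVertex_ssubset he hi
    have h1 := le_two_pow_mul_of_abs_sub_le (by positivity) hρ
      (ih _ hss (hA.mono hss.subset) fun e' h' => hmix e' (hss.subset h'))
    refine h1.trans (mul_le_mul (pow_le_pow_right₀ one_le_two ?_)
      (div_pow_card_deleteVertex_le hA hq hX0 i) (by positivity) (by positivity))
    have := Finset.card_lt_card hss
    omega
  have hmain := abs_homCount_sub_le hA hM hmix hE he
  have herase := ih _ (Finset.erase_ssubset he) (hA.mono (Finset.erase_subset _ _))
    fun e' h' => hmix e' (Finset.erase_subset _ _ h')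
  rw [← hn] at herase
  set B : ℝ := 2 ^ n * (X * q ^ (Fintype.card ι - 1) / q ^ #A) with hB
  have hB0 : 0 ≤ B := by positivity
  have hsqrt : √(homCount P E (deleteVertex A e.1)) * √(homCount P E (deleteVertex A e.2)) ≤ B := by
    rw [← Real.mul_self_sqrt hB0]
    exact mul_le_mul (Real.sqrt_le_sqrt (hdel _ (Or.inl rfl)))
      (Real.sqrt_le_sqrt (hdel _ (Or.inr rfl))) (Real.sqrt_nonneg _) (Real.sqrt_nonneg _)
  have h1 : |(homCount P E A : ℝ) - homCount P E (A.erase e) / q| ≤ 2 ^ n * ρ * (X / q ^ #A) := by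
    refine hmain.trans ((mul_le_mul_of_nonneg_left hsqrt (by positivity)).trans_eq ?_)
    rw [hB, hρdef]
    ring
  have h2 : |(homCount P E (A.erase e) : ℝ) / q - X / q ^ #A| ≤ (2 ^ n - 1) * ρ * (X / q ^ #A) := by
    have hsplit : X / q ^ #A = X / q ^ n / q := by rw [hcard, pow_succ, div_div]
    rw [hsplit, ← sub_div, abs_div, abs_of_pos (by positivity : (0 : ℝ) < q), ← mul_div_assoc]
    gcongr
  calc _ ≤ _ := abs_sub_le _ ((homCount P E (A.erase e) : ℝ) / q) _
    _ ≤ _ := add_le_add h1 h2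
    _ = _ := by rw [hcard, pow_succ (2 : ℝ)]; ring

theorem card_mul_card_filter_eq_le {i j : ι} (hij : i ≠ j) :
    #{x ∈ Fintype.piFinset fun _ : ι => E | (∀ e ∈ A, P e (x e.1) (x e.2)) ∧ x i = x j} * #E ≤
      homCount P E (deleteVertex A i) := by
  rw [← Finset.card_product]
  refine Finset.card_le_card_of_injOn (fun z => Function.update z.1 i z.2) ?_ ?_
  · rintro ⟨x, a⟩ h
    obtain ⟨hx, ha⟩ := Finset.mem_product.mp h
    obtain ⟨hxE, hxA, -⟩ := Finset.mem_filter.mp hx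
    refine Finset.mem_filter.mpr ⟨update_mem_piFinset hxE i ha, fun e he => ?_⟩
    obtain ⟨he, h1, h2⟩ := Finset.mem_filter.mp he
    simpa [Function.update_of_ne, h1, h2] using hxA e he
  · rintro ⟨x, a⟩ h ⟨y, b⟩ h' heq
    have hx := (Finset.mem_filter.mp (Finset.mem_product.mp h).1).2.2
    have hy := (Finset.mem_filter.mp (Finset.mem_product.mp h').1).2.2
    have hval : ∀ l, Function.update x i a l = Function.update y i b l := congrFun heq
    have hrest : ∀ l, l ≠ i → x l = y l := fun l hl => by
      simpa [Function.update_of_ne, hl] using hval l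
    have hab : a = b := by simpa using hval i
    have hxy : x = y := by
      funext l
      by_cases hl : l = i
      · subst hl
        exact hx.trans ((hrest j hij.symm).trans hy.symm)
      · exact hrest l hl
    rw [hab, hxy]

/-- Asymptotic count of tuples of distinct points satisfying a system of mixing constraints. -/
theorem abs_card_injective_sub_le {q M : ℝ} (hq : 1 ≤ q) (hM : 0 ≤ M) (hE : E.Nonempty)
    (hρ : M * q ^ (Fintype.card ι - 1) / #E ≤ 1) (hA : IsOriented A) (hmix : IsMixing P A q M)
    {s : Finset (ι → V)} (hs : ∀ x, x ∈ s ↔ Function.Injective x ∧ (∀ i, x i ∈ E) ∧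
      ∀ e ∈ A, P e (x e.1) (x e.2)) :
    |(#s : ℝ) - #E ^ Fintype.card ι / q ^ #A| ≤
      2 ^ #A * (M + Fintype.card ι ^ 2) * (q ^ (Fintype.card ι - 1) / #E) *
        (#E ^ Fintype.card ι / q ^ #A) := by
  obtain rfl : s = {x ∈ Fintype.piFinset fun _ : ι => E |
      (∀ e ∈ A, P e (x e.1) (x e.2)) ∧ Function.Injective x} := by
    ext x
    rw [hs, Finset.mem_filter, Fintype.mem_piFinset]
    tauto
  have hEpos : (0 : ℝ) < #E := by exact_mod_cast hE.card_pos
  set X : ℝ := #E ^ Fintype.card ι with hX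
  have hX0 : 0 ≤ X := by positivity
  set L : ι × ι → Finset (ι → V) := fun p =>
    {x ∈ Fintype.piFinset fun _ : ι => E | (∀ e ∈ A, P e (x e.1) (x e.2)) ∧ x p.1 = x p.2} with hL
  set B : ℝ := 2 ^ #A * (q ^ (Fintype.card ι - 1) / #E) * (X / q ^ #A) with hB
  have hB0 : 0 ≤ B := by positivity
  have hLcard : ∀ p ∈ (Finset.univ : Finset (ι × ι)).filter (fun p => p.1 ≠ p.2),
      (#(L p) : ℝ) ≤ B := by
    intro p hp
    have hp' := (Finset.mem_filter.mp hp).2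
    have h1 : (#(L p) * #E : ℝ) ≤ homCount P E (deleteVertex A p.1) := by
      exact_mod_cast card_mul_card_filter_eq_le (P := P) (E := E) (A := A) hp'
    have hsub : deleteVertex A p.1 ⊆ A := Finset.filter_subset _ _
    have h2 := le_two_pow_mul_of_abs_sub_le (by positivity) hρ
      (abs_homCount_sub_le_of_isMixing hq hM hE hρ (hA.mono hsub) fun e h => hmix e (hsub h))
    have h3 : (homCount P E (deleteVertex A p.1) : ℝ) ≤
        2 ^ #A * (X * q ^ (Fintype.card ι - 1) / q ^ #A) :=
      h2.trans (mul_le_mul (pow_le_pow_right₀ one_le_two (Finset.card_le_card hsub))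
        (div_pow_card_deleteVertex_le hA hq hX0 p.1) (by positivity) (by positivity))
    refine ((le_div_iff₀ hEpos).mpr (h1.trans h3)).trans_eq ?_
    rw [hB]
    ring
  have hsplit : homCount P E A = #{x ∈ Fintype.piFinset fun _ : ι => E |
        (∀ e ∈ A, P e (x e.1) (x e.2)) ∧ Function.Injective x} +
      #{x ∈ Fintype.piFinset fun _ : ι => E |
        (∀ e ∈ A, P e (x e.1) (x e.2)) ∧ ¬ Function.Injective x} := by
    rw [← Finset.filter_filter, ← Finset.filter_filter, Finset.card_filter_add_card_filter_not]
    rfl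
  have hnoninj : (#{x ∈ Fintype.piFinset fun _ : ι => E |
        (∀ e ∈ A, P e (x e.1) (x e.2)) ∧ ¬ Function.Injective x} : ℝ) ≤
      Fintype.card ι ^ 2 * B := by
    have hsub : {x ∈ Fintype.piFinset fun _ : ι => E |
        (∀ e ∈ A, P e (x e.1) (x e.2)) ∧ ¬ Function.Injective x} ⊆
        ((Finset.univ : Finset (ι × ι)).filter (fun p => p.1 ≠ p.2)).biUnion L := by
      intro x hx
      obtain ⟨hxE, hxA, hinj⟩ := Finset.mem_filter.mp hx
      obtain ⟨i, j, hij, hne⟩ := Function.not_injective_iff.mp hinj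
      exact Finset.mem_biUnion.mpr ⟨(i, j), Finset.mem_filter.mpr ⟨Finset.mem_univ _, hne⟩,
        Finset.mem_filter.mpr ⟨hxE, hxA, hij⟩⟩
    have h1 := (Finset.card_le_card hsub).trans Finset.card_biUnion_le
    calc _ ≤ ∑ p ∈ (Finset.univ : Finset (ι × ι)).filter (fun p => p.1 ≠ p.2), (#(L p) : ℝ) := by
          exact_mod_cast h1
      _ ≤ ∑ p ∈ (Finset.univ : Finset (ι × ι)).filter (fun p => p.1 ≠ p.2), B :=
          Finset.sum_le_sum hLcard
      _ ≤ ∑ p : ι × ι, B := Finset.sum_le_sum_of_subset_of_nonneg (Finset.filter_subset _ _)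
          fun _ _ _ => hB0
      _ = _ := by simp [sq]
  have hhom := abs_homCount_sub_le_of_isMixing hq hM hE hρ hA hmix
  rw [← hX] at hhom
  have hsplit' : (homCount P E A : ℝ) = _ + _ := (congrArg Nat.cast hsplit).trans (Nat.cast_add _ _)
  have hnn : (0 : ℝ) ≤ #{x ∈ Fintype.piFinset fun _ : ι => E |
        (∀ e ∈ A, P e (x e.1) (x e.2)) ∧ ¬ Function.Injective x} := Nat.cast_nonneg _
  have hfin : (2 ^ #A - 1) * (M * q ^ (Fintype.card ι - 1) / #E) * (X / q ^ #A) ≤ M * B := by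
    rw [hB]
    have : 0 ≤ M * q ^ (Fintype.card ι - 1) / #E * (X / q ^ #A) := by positivity
    refine (mul_assoc _ _ _).trans_le ((mul_le_mul_of_nonneg_right
      (sub_le_self (2 ^ #A : ℝ) zero_le_one) this).trans_eq ?_)
    ring
  have htot : 2 ^ #A * (M + Fintype.card ι ^ 2) * (q ^ (Fintype.card ι - 1) / #E) * (X / q ^ #A) =
      M * B + Fintype.card ι ^ 2 * B := by
    rw [hB]
    ring
  rw [htot, abs_le]
  have h3 := abs_le.mp hhom
  constructor
  · linarith [h3.1]
  · have : 0 ≤ (Fintype.card ι : ℝ) ^ 2 * B := by positivity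
    linarith [h3.2]

end Induction

section Final

/-- The edges of a graph, each oriented increasingly. -/
noncomputable def orientedEdges {ι : Type*} [Fintype ι] [LinearOrder ι] (H : SimpleGraph ι) :
    Finset (ι × ι) :=
  {e | e.1 < e.2 ∧ H.Adj e.1 e.2}

theorem isOriented_orientedEdges {ι : Type*} [Fintype ι] [LinearOrder ι] (H : SimpleGraph ι) :
    IsOriented (orientedEdges H) := by
  intro e he
  have h := (Finset.mem_filter.mp he).2.1
  exact ⟨h.ne, fun h' => h.asymm (Finset.mem_filter.mp h').2.1⟩

theorem card_orientedEdges {ι : Type*} [Fintype ι] [LinearOrder ι] (H : SimpleGraph ι)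
    [Fintype H.edgeSet] : #(orientedEdges H) = #H.edgeFinset := by
  refine Finset.card_bij (fun e _ => s(e.1, e.2)) ?_ ?_ ?_
  · intro e he
    simpa using (Finset.mem_filter.mp he).2.2
  · rintro ⟨u, v⟩ he ⟨u', v'⟩ he' heq
    have h1 : u < v := (Finset.mem_filter.mp he).2.1
    have h2 : u' < v' := (Finset.mem_filter.mp he').2.1
    rcases Sym2.eq_iff.mp heq with ⟨h3, h4⟩ | ⟨h3, h4⟩
    · exact Prod.ext h3 h4
    · simp only at h3 h4
      subst h3; subst h4
      exact absurd h1 h2.asymm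
  · intro s
    induction s using Sym2.ind with
    | _ u v =>
    intro h
    have h : H.Adj u v := by simpa using h
    rcases lt_or_gt_of_ne h.ne with huv | huv
    · exact ⟨(u, v), Finset.mem_filter.mpr ⟨Finset.mem_univ _, huv, h⟩, rfl⟩
    · exact ⟨(v, u), Finset.mem_filter.mpr ⟨Finset.mem_univ _, huv, h.symm⟩, Sym2.eq_swap⟩

theorem forall_adj_iff_forall_orientedEdges {ι : Type*} [Fintype ι] [LinearOrder ι]
    (H : SimpleGraph ι) {p : ι → ι → Prop} (hp : ∀ i j, p i j → p j i) :
    (∀ i j, H.Adj i j → p i j) ↔ ∀ e ∈ orientedEdges H, p e.1 e.2 := by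
  constructor
  · intro h e he
    exact h _ _ (Finset.mem_filter.mp he).2.2
  · intro h i j hij
    rcases lt_or_gt_of_ne hij.ne with hlt | hlt
    · exact h (i, j) (Finset.mem_filter.mpr ⟨Finset.mem_univ _, hlt, hij⟩)
    · exact hp _ _ (h (j, i) (Finset.mem_filter.mpr ⟨Finset.mem_univ _, hlt, hij.symm⟩))

theorem sqrt_pow_div_mul_pow_eq_rpow {q : ℝ} (hq : 0 < q) (d : ℕ) {k : ℕ} (hk : 1 ≤ k) :
    √q ^ (d + 1) / q * q ^ (k - 1) = q ^ (((d : ℝ) - 1) / 2 + (k : ℝ) - 1) := by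
  rw [Real.sqrt_eq_rpow, ← Real.rpow_natCast, ← Real.rpow_natCast, ← Real.rpow_mul hq.le,
    div_eq_mul_inv, ← Real.rpow_neg_one, ← Real.rpow_add hq, ← Real.rpow_add hq]
  congr 1
  push_cast [Nat.cast_sub hk]
  ring

theorem pow_le_rpow_of_one_le {q : ℝ} (hq : 1 ≤ q) {d k : ℕ} (hd : 1 ≤ d) (hk : 1 ≤ k) :
    q ^ (k - 1) ≤ q ^ (((d : ℝ) - 1) / 2 + (k : ℝ) - 1) := by
  rw [← Real.rpow_natCast]
  refine Real.rpow_le_rpow_of_exponent_le hq ?_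
  have : (1 : ℝ) ≤ d := by exact_mod_cast hd
  push_cast [Nat.cast_sub hk]
  linarith

end Final

/-- Main theorem: Let `d ≥ 2`, `1 ≤ k - 1 ≤ n ≤ d`, `ε > 0`. There is
`C > 0` such that for every odd prime power `q`, every nondegenerate quadratic form `Q`
on `𝔽_q^d`, every graph `H` on `{1, …, k}` with `n` edges whose edges are colored by
elements of `𝔽_q^*`, and every `E ⊆ 𝔽_q^d` with `|E| ≥ C q^((d-1)/2 + k - 1)`, the
number `N` of labelled copies of the colored graph `H` inside `E` satisfies
`|N - |E|^k q^(-n)| ≤ ε |E|^k q^(-n)`. -/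
theorem euclidean_graph_colored_subgraphs (d k n : ℕ) (hd : 2 ≤ d)
    (hk : 2 ≤ k) (hkn : k - 1 ≤ n) (hnd : n ≤ d)
    (ε : ℝ) (hε : 0 < ε) :
    ∃ C : ℝ, 0 < C ∧
      ∀ (q : ℕ), IsPrimePow q → Odd q →
      ∀ (K : Type) [Field K] [Fintype K], Fintype.card K = q →
      ∀ (Q : QuadraticForm K (Fin d → K)),
      (∀ x : Fin d → K, (∀ y : Fin d → K, Q (x + y) - Q x - Q y = 0) → x = 0) →
      ∀ (H : SimpleGraph (Fin k)), H.edgeFinset.card = n →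
      ∀ (c : Sym2 (Fin k) → K), (∀ e ∈ H.edgeSet, c e ≠ 0) →
      ∀ (E : Finset (Fin d → K)),
      C * (q : ℝ) ^ (((d : ℝ) - 1) / 2 + (k : ℝ) - 1) ≤ E.card →
      |((Finset.univ.filter (fun x : Fin k → (Fin d → K) =>
            Function.Injective x ∧ (∀ i, x i ∈ E) ∧
            ∀ i j, H.Adj i j → Q (x i - x j) = c s(i, j))).card : ℝ)
          - (E.card : ℝ) ^ k / (q : ℝ) ^ n|
        ≤ ε * ((E.card : ℝ) ^ k / (q : ℝ) ^ n) := by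
  refine ⟨2 + 2 ^ n * (2 + k ^ 2) / ε, by positivity, ?_⟩
  rintro q - hodd K _ _ rfl Q hQ H rfl c hc E hE
  set C : ℝ := 2 + 2 ^ #H.edgeFinset * (2 + k ^ 2) / ε with hC
  set q : ℝ := (Fintype.card K : ℝ) with hq
  have hq1 : 1 ≤ q := by
    rw [hq]
    exact_mod_cast Fintype.card_pos (α := K)
  have hq0 : 0 < q := zero_lt_one.trans_le hq1
  set r : ℝ := q ^ (((d : ℝ) - 1) / 2 + (k : ℝ) - 1) with hr
  have hr0 : 0 < r := Real.rpow_pos_of_pos hq0 _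
  have hC2 : 2 ≤ C := le_add_of_nonneg_right (by positivity)
  have hEpos : (0 : ℝ) < #E := (mul_pos (by linarith) hr0).trans_le hE
  have hEne : E.Nonempty := Finset.card_pos.mp (by exact_mod_cast hEpos)
  set P : Fin k × Fin k → (Fin d → K) → (Fin d → K) → Prop :=
    fun e x y => Q (x - y) = c s(e.1, e.2) with hP
  set M : ℝ := 2 * √q ^ (d + 1) / q with hM
  have hmix : IsMixing P (orientedEdges H) q M := fun e he S T =>
    abs_card_filter_sub_le hodd hQ (hc _ (Finset.mem_filter.mp he).2.2) S T
  have hMr : M * q ^ (k - 1) = 2 * r := by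
    rw [hr, ← sqrt_pow_div_mul_pow_eq_rpow hq0 d (by omega : 1 ≤ k), hM]
    ring
  have hqr : q ^ (k - 1) ≤ r := pow_le_rpow_of_one_le hq1 (by omega) (by omega)
  have hmain := abs_card_injective_sub_le (ι := Fin k) hq1 (by positivity) hEne
    (by rw [Fintype.card_fin, hMr, div_le_one hEpos]; nlinarith) (isOriented_orientedEdges H) hmix
    (s := Finset.univ.filter (fun x : Fin k → (Fin d → K) =>
      Function.Injective x ∧ (∀ i, x i ∈ E) ∧
        ∀ i j, H.Adj i j → Q (x i - x j) = c s(i, j)))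
    fun x => by
      rw [Finset.mem_filter, forall_adj_iff_forall_orientedEdges H
        (p := fun i j => Q (x i - x j) = c s(i, j))
        fun i j h => by rw [Sym2.eq_swap, ← h, ← QuadraticMap.map_neg, neg_sub]]
      simp only [Finset.mem_univ, true_and]
      exact Iff.rfl
  rw [Fintype.card_fin, card_orientedEdges] at hmain
  refine hmain.trans (mul_le_mul_of_nonneg_right ?_ (by positivity))
  calc 2 ^ #H.edgeFinset * (M + (k : ℝ) ^ 2) * (q ^ (k - 1) / #E)
      = 2 ^ #H.edgeFinset * (M * q ^ (k - 1) + (k : ℝ) ^ 2 * q ^ (k - 1)) / #E := by ring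
    _ ≤ 2 ^ #H.edgeFinset * (2 * r + (k : ℝ) ^ 2 * r) / #E := by
        rw [hMr]
        gcongr
    _ ≤ ε := by
        rw [div_le_iff₀ hEpos]
        calc (2 ^ #H.edgeFinset * (2 * r + (k : ℝ) ^ 2 * r) : ℝ)
            = ε * (2 ^ #H.edgeFinset * (2 + k ^ 2) / ε * r) := by field_simp
          _ ≤ ε * (C * r) := by
              gcongr
              linarith
          _ ≤ ε * #E := by gcongr
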